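/- arXiv:2601.21200 — 4 statements merged into one kernel-verified Lean document; each statement's English description precedes it below -/
import Mathlib

section
/- Let μ be a probability measure on ℝ^d, λ ∈ (0, 1], σ > 0, and let f_μ be the Gaussian-smoothed density of μ. Then f_μ is smooth and strictly positive, and for every x ∈ ℝ^d: (1) ∇ log f_μ(x) = σ^{−2} ( λ m_μ(x) − x ), and (2) ∇² log f_μ(x) = λ² σ^{−4} Σ_μ(x) − σ^{−2} I_d, where m_μ(x) is the posterior mean and Σ_μ(x) the posterior covariance of μ at x. -/
open MeasureTheory Real

/-- The Gaussian kernel `(2πσ²)^{-d/2} exp(-‖x - λz‖²/(2σ²))`. -/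
noncomputable def gaussKernel (d : ℕ) (lam sig : ℝ)
    (x z : EuclideanSpace ℝ (Fin d)) : ℝ :=
  (2 * π * sig ^ 2) ^ (-(d : ℝ) / 2) * Real.exp (-‖x - lam • z‖ ^ 2 / (2 * sig ^ 2))

/-- The Gaussian-smoothed density `f_μ(x) = ∫ (2πσ²)^{-d/2} exp(-‖x-λz‖²/(2σ²)) dμ(z)`,
i.e. the density of `λZ + σξ` with `Z ∼ μ`, `ξ ∼ N(0, I_d)` independent. -/
noncomputable def smoothedDensity (d : ℕ) (lam sig : ℝ)
    (μ : Measure (EuclideanSpace ℝ (Fin d))) (x : EuclideanSpace ℝ (Fin d)) : ℝ :=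
  ∫ z, gaussKernel d lam sig x z ∂μ

/-- The posterior mean `m_μ(x)`. -/
noncomputable def postMean (d : ℕ) (lam sig : ℝ)
    (μ : Measure (EuclideanSpace ℝ (Fin d))) (x : EuclideanSpace ℝ (Fin d)) :
    EuclideanSpace ℝ (Fin d) :=
  (smoothedDensity d lam sig μ x)⁻¹ • ∫ z, gaussKernel d lam sig x z • z ∂μ

/-- The posterior covariance matrix `Σ_μ(x)`. -/
noncomputable def postCov (d : ℕ) (lam sig : ℝ)
    (μ : Measure (EuclideanSpace ℝ (Fin d))) (x : EuclideanSpace ℝ (Fin d)) :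
    Matrix (Fin d) (Fin d) ℝ :=
  fun i j => (smoothedDensity d lam sig μ x)⁻¹ *
    ∫ z, gaussKernel d lam sig x z *
      ((z i - postMean d lam sig μ x i) * (z j - postMean d lam sig μ x j)) ∂μ

section Helpers

open Function

variable {d : ℕ} {F : Type} [NormedAddCommGroup F] [NormedSpace ℝ F]

/-- The derivative operator on the polynomial factor of a Gaussian. -/
noncomputable def gD (c : ℝ) (p : EuclideanSpace ℝ (Fin d) → F)
    (u : EuclideanSpace ℝ (Fin d)) : EuclideanSpace ℝ (Fin d) →L[ℝ] F :=
  fderiv ℝ p u - (2 * c) • ContinuousLinearMap.smulRightL ℝ _ F (innerSL ℝ u) (p u)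

/-- The Gaussian integral with a temperate factor. -/
noncomputable def gI (c lam : ℝ) (μ : Measure (EuclideanSpace ℝ (Fin d)))
    (p : EuclideanSpace ℝ (Fin d) → F) (x : EuclideanSpace ℝ (Fin d)) : F :=
  ∫ z, Real.exp (-(c * ‖x - lam • z‖ ^ 2)) • p (x - lam • z) ∂μ

lemma temperate_fderiv {p : EuclideanSpace ℝ (Fin d) → F} (hp : p.HasTemperateGrowth) :
    (fderiv ℝ p).HasTemperateGrowth := by
  refine ⟨hp.1.fderiv_right (by simp), fun n => ?_⟩
  obtain ⟨k, C, h⟩ := hp.2 (n + 1)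
  exact ⟨k, C, fun x => by rw [norm_iteratedFDeriv_fderiv]; exact h x⟩

lemma temperate_gD (c : ℝ) {p : EuclideanSpace ℝ (Fin d) → F} (hp : p.HasTemperateGrowth) :
    (gD c p).HasTemperateGrowth := by
  have h1 := (ContinuousLinearMap.smulRightL ℝ (EuclideanSpace ℝ (Fin d)) F).bilinear_hasTemperateGrowth
    (innerSL ℝ (E := EuclideanSpace ℝ (Fin d))).hasTemperateGrowth hp
  exact (temperate_fderiv hp).sub ((HasTemperateGrowth.const (2 * c)).smul h1)

lemma gauss_bounded {c : ℝ} (hc : 0 < c) {p : EuclideanSpace ℝ (Fin d) → F}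
    (hp : p.HasTemperateGrowth) :
    ∃ B, ∀ u, ‖Real.exp (-(c * ‖u‖ ^ 2)) • p u‖ ≤ B := by
  obtain ⟨k, C, hC, h⟩ := hp.norm_iteratedFDeriv_le_uniform 0
  refine ⟨C * (k.factorial * Real.exp (1 + 1 / (4 * c))), fun u => ?_⟩
  have h0 := h 0 le_rfl u
  rw [norm_iteratedFDeriv_zero] at h0
  have h1 : (1 + ‖u‖) ^ k ≤ k.factorial * Real.exp (1 + ‖u‖) := by
    have := Real.pow_div_factorial_le_exp (x := 1 + ‖u‖) (by positivity) k
    rwa [div_le_iff₀' (by positivity)] at this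
  have h2 : 1 + ‖u‖ - c * ‖u‖ ^ 2 ≤ 1 + 1 / (4 * c) := by
    have : 1 / (4 * c) - ‖u‖ + c * ‖u‖ ^ 2 = c * (‖u‖ - 1 / (2 * c)) ^ 2 := by
      field_simp; ring
    have : 0 ≤ c * (‖u‖ - 1 / (2 * c)) ^ 2 := by positivity
    linarith
  rw [norm_smul, Real.norm_of_nonneg (Real.exp_nonneg _)]
  calc Real.exp (-(c * ‖u‖ ^ 2)) * ‖p u‖
      ≤ Real.exp (-(c * ‖u‖ ^ 2)) * (C * (k.factorial * Real.exp (1 + ‖u‖))) := by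
        gcongr
        exact h0.trans (by gcongr)
    _ = C * (k.factorial * Real.exp (1 + ‖u‖ - c * ‖u‖ ^ 2)) := by
        rw [sub_eq_add_neg, Real.exp_add _ (-(c * ‖u‖ ^ 2))]; ring
    _ ≤ _ := by gcongr

lemma gauss_integrable {c : ℝ} (hc : 0 < c) (lam : ℝ)
    (μ : Measure (EuclideanSpace ℝ (Fin d))) [IsProbabilityMeasure μ]
    {p : EuclideanSpace ℝ (Fin d) → F}
    (hp : p.HasTemperateGrowth) (x : EuclideanSpace ℝ (Fin d)) :
    Integrable (fun z => Real.exp (-(c * ‖x - lam • z‖ ^ 2)) • p (x - lam • z)) μ := by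
  obtain ⟨B, hB⟩ := gauss_bounded hc hp
  have hpc : Continuous p := hp.1.continuous
  refine Integrable.of_bound (C := B) ?_ (Filter.Eventually.of_forall fun z => hB _)
  exact Continuous.aestronglyMeasurable (by fun_prop)

lemma gauss_hasFDerivAt (c : ℝ) {p : EuclideanSpace ℝ (Fin d) → F}
    (hp : p.HasTemperateGrowth) (u : EuclideanSpace ℝ (Fin d)) :
    HasFDerivAt (fun u => Real.exp (-(c * ‖u‖ ^ 2)) • p u)
      (Real.exp (-(c * ‖u‖ ^ 2)) • gD c p u) u := by
  have h1 : HasFDerivAt p (fderiv ℝ p u) u :=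
    (hp.1.differentiable (by simp) u).hasFDerivAt
  have h2 := (((hasStrictFDerivAt_norm_sq u).hasFDerivAt.const_mul c).neg).exp
  refine (h2.smul h1).congr_fderiv ?_
  ext v
  simp only [gD, add_apply, smul_apply, sub_apply, neg_apply,
    ContinuousLinearMap.smulRightL_apply_apply, ContinuousLinearMap.smulRight_apply,
    innerSL_apply_apply, smul_eq_mul, nsmul_eq_mul]
  push_cast
  module

lemma gI_hasFDerivAt {c : ℝ} (hc : 0 < c) (lam : ℝ)
    (μ : Measure (EuclideanSpace ℝ (Fin d))) [IsProbabilityMeasure μ]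
    {p : EuclideanSpace ℝ (Fin d) → F}
    (hp : p.HasTemperateGrowth) (x : EuclideanSpace ℝ (Fin d)) :
    HasFDerivAt (gI c lam μ p) (gI c lam μ (gD c p) x) x := by
  obtain ⟨B, hB⟩ := gauss_bounded hc (temperate_gD c hp)
  refine hasFDerivAt_integral_of_dominated_of_fderiv_le (bound := fun _ => B)
    (F' := fun x z => Real.exp (-(c * ‖x - lam • z‖ ^ 2)) • gD c p (x - lam • z))
    Filter.univ_mem
    (Filter.Eventually.of_forall fun x => (gauss_integrable hc lam μ hp x).aestronglyMeasurable)
    (gauss_integrable hc lam μ hp x)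
    (gauss_integrable hc lam μ (temperate_gD c hp) x).aestronglyMeasurable
    (Filter.Eventually.of_forall fun z x _ => hB _) (integrable_const _)
    (Filter.Eventually.of_forall fun z x _ => ?_)
  exact (gauss_hasFDerivAt c hp (x - lam • z)).comp x ((hasFDerivAt_id x).sub_const (lam • z))

lemma gI_contDiff {c : ℝ} (hc : 0 < c) (lam : ℝ)
    (μ : Measure (EuclideanSpace ℝ (Fin d))) [IsProbabilityMeasure μ] (n : ℕ) :
    ∀ {F : Type} [NormedAddCommGroup F] [NormedSpace ℝ F]
    {p : EuclideanSpace ℝ (Fin d) → F} (_ : p.HasTemperateGrowth),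
    ContDiff ℝ n (gI c lam μ p) := by
  induction n with
  | zero =>
    intro F _ _ p hp
    exact contDiff_zero.2
      (continuous_iff_continuousAt.2 fun x => (gI_hasFDerivAt hc lam μ hp x).continuousAt)
  | succ n ih =>
    intro F _ _ p hp
    exact contDiff_succ_iff_hasFDerivAt.2
      ⟨gI c lam μ (gD c p), ih (temperate_gD c hp), gI_hasFDerivAt hc lam μ hp⟩

lemma gD_const_apply (c K : ℝ) (u v : EuclideanSpace ℝ (Fin d)) :
    gD c (fun _ => K) u v = -(2 * c) * (K * inner ℝ u v) := by
  simp only [gD, fderiv_const_apply, smul_apply, sub_apply, zero_apply,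
    ContinuousLinearMap.smulRightL_apply_apply, ContinuousLinearMap.smulRight_apply,
    innerSL_apply_apply, smul_eq_mul]
  ring

lemma gD_gD_const_apply (c K : ℝ) (u v w : EuclideanSpace ℝ (Fin d)) :
    gD c (gD c (fun _ => K)) u v w
      = -(2 * c) * (K * inner ℝ v w) + (2 * c) ^ 2 * (K * inner ℝ u v * inner ℝ u w) := by
  have h : gD c (fun _ : EuclideanSpace ℝ (Fin d) => K) =
      ⇑((-(2 * c) * K) • innerSL ℝ (E := EuclideanSpace ℝ (Fin d))) := by
    ext1 u
    ext1 v
    rw [gD_const_apply]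
    simp only [smul_apply, innerSL_apply_apply, smul_eq_mul]
    ring
  have e : fderiv ℝ (gD c (fun _ : EuclideanSpace ℝ (Fin d) => K)) u v w
      = (-(2 * c) * K) * inner ℝ v w := by
    rw [h, ContinuousLinearMap.fderiv]; rfl
  rw [gD, sub_apply, sub_apply, e]
  simp only [gD_const_apply, smul_apply, sub_apply,
    ContinuousLinearMap.smulRightL_apply_apply, ContinuousLinearMap.smulRight_apply,
    innerSL_apply_apply, smul_eq_mul]
  ring

/-- Everything in terms of scalar Gaussian integrals. -/
lemma gI_gD_apply {c : ℝ} (hc : 0 < c) (lam K : ℝ)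
    (μ : Measure (EuclideanSpace ℝ (Fin d))) [IsProbabilityMeasure μ]
    (x v : EuclideanSpace ℝ (Fin d)) :
    gI c lam μ (gD c (fun _ => K)) x v
      = -(2 * c) * gI c lam μ (fun u => K * inner ℝ u v) x := by
  have hK : HasTemperateGrowth (fun _ : EuclideanSpace ℝ (Fin d) => K) := .const K
  rw [gI, ContinuousLinearMap.integral_apply (gauss_integrable hc lam μ (temperate_gD c hK) x),
    gI, ← integral_const_mul]
  refine integral_congr_ae (Filter.Eventually.of_forall fun z => ?_)
  simp only [smul_apply, gD_const_apply, smul_eq_mul]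
  ring

lemma gI_gD_gD_apply {c : ℝ} (hc : 0 < c) (lam K : ℝ)
    (μ : Measure (EuclideanSpace ℝ (Fin d))) [IsProbabilityMeasure μ]
    (x v w : EuclideanSpace ℝ (Fin d)) :
    gI c lam μ (gD c (gD c (fun _ => K))) x v w
      = -(2 * c) * inner ℝ v w * gI c lam μ (fun _ => K) x
        + (2 * c) ^ 2 * gI c lam μ (fun u => K * inner ℝ u v * inner ℝ u w) x := by
  have hK : HasTemperateGrowth (fun _ : EuclideanSpace ℝ (Fin d) => K) := .const K
  have h2 := temperate_gD c (temperate_gD c hK)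
  have h3 : HasTemperateGrowth
    (fun u : EuclideanSpace ℝ (Fin d) => K * inner ℝ u v * inner ℝ u w) := by fun_prop
  have hi := gauss_integrable hc lam μ h2 x
  rw [gI, ContinuousLinearMap.integral_apply hi,
    ContinuousLinearMap.integral_apply (hi.apply_continuousLinearMap v),
    gI, gI, ← integral_const_mul, ← integral_const_mul, ← integral_add
      ((gauss_integrable hc lam μ hK x).const_mul _) ((gauss_integrable hc lam μ h3 x).const_mul _)]
  refine integral_congr_ae (Filter.Eventually.of_forall fun z => ?_)
  simp only [smul_apply, gD_gD_const_apply, smul_eq_mul]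
  ring

lemma kernel_eq (lam sig : ℝ) (x z : EuclideanSpace ℝ (Fin d)) :
    gaussKernel d lam sig x z = Real.exp (-((2 * sig ^ 2)⁻¹ * ‖x - lam • z‖ ^ 2)) *
      (2 * π * sig ^ 2) ^ (-(d : ℝ) / 2) := by
  rw [gaussKernel, mul_comm]
  congr 2
  rw [div_eq_inv_mul]
  ring

lemma dens_eq (lam sig : ℝ) (μ : Measure (EuclideanSpace ℝ (Fin d))) :
    smoothedDensity d lam sig μ =
      gI (2 * sig ^ 2)⁻¹ lam μ (fun _ => (2 * π * sig ^ 2) ^ (-(d : ℝ) / 2)) := by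
  ext x
  simp only [smoothedDensity, gI, kernel_eq, smul_eq_mul]

lemma dens_pos {lam sig : ℝ} (hsig : 0 < sig) (μ : Measure (EuclideanSpace ℝ (Fin d)))
    [IsProbabilityMeasure μ] (x : EuclideanSpace ℝ (Fin d)) :
    0 < smoothedDensity d lam sig μ x := by
  have hi : Integrable (fun z => gaussKernel d lam sig x z) μ := by
    have := gauss_integrable (c := (2 * sig ^ 2)⁻¹) (by positivity) lam μ
      (HasTemperateGrowth.const ((2 * π * sig ^ 2) ^ (-(d : ℝ) / 2))) x
    simpa only [kernel_eq, smul_eq_mul] using this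
  have hp : ∀ z, 0 < gaussKernel d lam sig x z := fun z => by
    rw [gaussKernel]; positivity
  rw [smoothedDensity, integral_pos_iff_support_of_nonneg (fun z => (hp z).le) hi]
  have : support (fun z => gaussKernel d lam sig x z) = Set.univ := by
    ext z; simpa using (hp z).ne'
  rw [this]; simp

lemma mean_inner {lam sig : ℝ} (hlam : 0 < lam) (hsig : 0 < sig)
    (μ : Measure (EuclideanSpace ℝ (Fin d)))
    [IsProbabilityMeasure μ] (x w : EuclideanSpace ℝ (Fin d)) :
    lam * inner ℝ (postMean d lam sig μ x) w = inner ℝ x w - (smoothedDensity d lam sig μ x)⁻¹ *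
      gI (2 * sig ^ 2)⁻¹ lam μ
        (fun u => (2 * π * sig ^ 2) ^ (-(d : ℝ) / 2) * inner ℝ u w) x := by
  have hf := dens_pos (lam := lam) hsig μ x
  have hc : 0 < (2 * sig ^ 2)⁻¹ := by positivity
  set K := (2 * π * sig ^ 2) ^ (-(d : ℝ) / 2) with hK
  have hKt : HasTemperateGrowth (fun _ : EuclideanSpace ℝ (Fin d) => K) := .const K
  have hAt : HasTemperateGrowth (fun u : EuclideanSpace ℝ (Fin d) => K * inner ℝ u w) := by
    fun_prop
  have hi : Integrable (fun z => gaussKernel d lam sig x z • z) μ := by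
    have h1 : HasTemperateGrowth (fun u : EuclideanSpace ℝ (Fin d) => (K * lam⁻¹) • (x - u)) := by
      fun_prop
    refine (gauss_integrable hc lam μ h1 x).congr (Filter.Eventually.of_forall fun z => ?_)
    simp only [kernel_eq, ← hK, sub_sub_cancel, smul_smul]
    congr 1
    field_simp
  have key : lam * ∫ z, inner ℝ w (gaussKernel d lam sig x z • z) ∂μ
      = inner ℝ x w * smoothedDensity d lam sig μ x
        - gI (2 * sig ^ 2)⁻¹ lam μ (fun u => K * inner ℝ u w) x := by
    rw [dens_eq, gI, gI, ← integral_const_mul, ← integral_const_mul, ← integral_sub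
      ((gauss_integrable hc lam μ hKt x).const_mul _) (gauss_integrable hc lam μ hAt x)]
    refine integral_congr_ae (Filter.Eventually.of_forall fun z => ?_)
    simp only [kernel_eq, ← hK, smul_eq_mul, inner_sub_left, inner_smul_left, inner_smul_right,
      real_inner_comm w z, conj_trivial]
    ring
  rw [integral_inner hi] at key
  rw [postMean, inner_smul_left, conj_trivial, real_inner_comm,
    mul_left_comm, key]
  field_simp

lemma intg_sub {μ : Measure (EuclideanSpace ℝ (Fin d))} {f g : EuclideanSpace ℝ (Fin d) → ℝ}
    (hf : Integrable f μ) (hg : Integrable g μ) : Integrable (fun z => f z - g z) μ :=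
  hf.sub hg

lemma cov_eq {lam sig : ℝ} (hlam : 0 < lam) (hsig : 0 < sig)
    (μ : Measure (EuclideanSpace ℝ (Fin d)))
    [IsProbabilityMeasure μ] (x : EuclideanSpace ℝ (Fin d)) (i j : Fin d)
    (K : ℝ) (hK : K = (2 * π * sig ^ 2) ^ (-(d : ℝ) / 2))
    (a b : EuclideanSpace ℝ (Fin d)) (ha : a = EuclideanSpace.single i 1)
    (hb : b = EuclideanSpace.single j 1) :
    lam ^ 2 * postCov d lam sig μ x i j = (smoothedDensity d lam sig μ x)⁻¹ *
      gI (2 * sig ^ 2)⁻¹ lam μ (fun u => K * inner ℝ u a * inner ℝ u b) x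
      - ((smoothedDensity d lam sig μ x)⁻¹ *
          gI (2 * sig ^ 2)⁻¹ lam μ (fun u => K * inner ℝ u a) x) *
        ((smoothedDensity d lam sig μ x)⁻¹ *
          gI (2 * sig ^ 2)⁻¹ lam μ (fun u => K * inner ℝ u b) x) := by
  have hf := dens_pos (lam := lam) hsig μ x
  have hc : 0 < (2 * sig ^ 2)⁻¹ := by positivity
  have hca : ∀ v : EuclideanSpace ℝ (Fin d), v i = inner ℝ v a := fun v => by
    rw [ha, EuclideanSpace.inner_single_right]; simp
  have hcb : ∀ v : EuclideanSpace ℝ (Fin d), v j = inner ℝ v b := fun v => by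
    rw [hb, EuclideanSpace.inner_single_right]; simp
  have hma := mean_inner hlam hsig μ x a
  have hmb := mean_inner hlam hsig μ x b
  rw [← hK] at hma hmb
  set A := gI (2 * sig ^ 2)⁻¹ lam μ (fun u => K * inner ℝ u a) x with hA
  set B := gI (2 * sig ^ 2)⁻¹ lam μ (fun u => K * inner ℝ u b) x with hB
  set f := smoothedDensity d lam sig μ x with hfd
  have hKt : HasTemperateGrowth (fun _ : EuclideanSpace ℝ (Fin d) => K) := .const K
  have hAt : HasTemperateGrowth (fun u : EuclideanSpace ℝ (Fin d) => K * inner ℝ u a) := by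
    fun_prop
  have hBt : HasTemperateGrowth (fun u : EuclideanSpace ℝ (Fin d) => K * inner ℝ u b) := by
    fun_prop
  have hCt : HasTemperateGrowth
    (fun u : EuclideanSpace ℝ (Fin d) => K * inner ℝ u a * inner ℝ u b) := by fun_prop
  have key : lam ^ 2 * ∫ z, gaussKernel d lam sig x z *
      ((z i - postMean d lam sig μ x i) * (z j - postMean d lam sig μ x j)) ∂μ
      = gI (2 * sig ^ 2)⁻¹ lam μ (fun u => K * inner ℝ u a * inner ℝ u b) x
        - (f⁻¹ * B) * A - (f⁻¹ * A) * B + (f⁻¹ * A) * (f⁻¹ * B) * f := by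
    have hff : f = gI (2 * sig ^ 2)⁻¹ lam μ (fun _ => K) x := by rw [hfd, dens_eq, hK]
    have e1 : f⁻¹ * B * A = ∫ z, (f⁻¹ * B) * (Real.exp (-((2 * sig ^ 2)⁻¹ * ‖x - lam • z‖ ^ 2)) •
        (K * inner ℝ (x - lam • z) a)) ∂μ := by rw [integral_const_mul]; rfl
    have e2 : f⁻¹ * A * B = ∫ z, (f⁻¹ * A) * (Real.exp (-((2 * sig ^ 2)⁻¹ * ‖x - lam • z‖ ^ 2)) •
        (K * inner ℝ (x - lam • z) b)) ∂μ := by rw [integral_const_mul]; rfl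
    have e3 : (f⁻¹ * A) * (f⁻¹ * B) * f = ∫ z, ((f⁻¹ * A) * (f⁻¹ * B)) *
        (Real.exp (-((2 * sig ^ 2)⁻¹ * ‖x - lam • z‖ ^ 2)) • K) ∂μ := by
      rw [integral_const_mul]
      congr 1
    have iA := (gauss_integrable hc lam μ hAt x).const_mul (f⁻¹ * B)
    have iB := (gauss_integrable hc lam μ hBt x).const_mul (f⁻¹ * A)
    have iK := (gauss_integrable hc lam μ hKt x).const_mul ((f⁻¹ * A) * (f⁻¹ * B))
    have iC := gauss_integrable hc lam μ hCt x
    rw [e1, e2, e3, gI, ← integral_sub iC iA, ← integral_sub (intg_sub iC iA) iB,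
      ← integral_add (intg_sub (intg_sub iC iA) iB) iK, ← integral_const_mul]
    refine integral_congr_ae (Filter.Eventually.of_forall fun z => ?_)
    simp only [kernel_eq, ← hK, smul_eq_mul, hca, hcb, inner_sub_left, inner_smul_left,
      conj_trivial]
    generalize inner ℝ (postMean d lam sig μ x) a = ma at *
    generalize inner ℝ (postMean d lam sig μ x) b = mb at *
    have e4 : f⁻¹ * A = inner ℝ x a - lam * ma := by linarith
    have e5 : f⁻¹ * B = inner ℝ x b - lam * mb := by linarith
    rw [e4, e5]
    ring
  rw [postCov, mul_left_comm, key, ← hfd]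
  generalize gI (2 * sig ^ 2)⁻¹ lam μ (fun u => K * inner ℝ u a * inner ℝ u b) x = D
  field_simp
  ring

end Helpers

theorem stmt5 (d : ℕ) (μ : Measure (EuclideanSpace ℝ (Fin d))) [IsProbabilityMeasure μ]
    (lam sig : ℝ) (hlam : lam ∈ Set.Ioc (0 : ℝ) 1) (hsig : 0 < sig) :
    ContDiff ℝ (⊤ : ℕ∞) (smoothedDensity d lam sig μ) ∧
    (∀ x, 0 < smoothedDensity d lam sig μ x) ∧
    (∀ x, gradient (fun x => Real.log (smoothedDensity d lam sig μ x)) x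
        = (sig ^ 2)⁻¹ • (lam • postMean d lam sig μ x - x)) ∧
    (∀ x, ∀ i j : Fin d,
      iteratedFDeriv ℝ 2 (fun x => Real.log (smoothedDensity d lam sig μ x)) x
          ![EuclideanSpace.single i 1, EuclideanSpace.single j 1]
        = lam ^ 2 * (sig ^ 4)⁻¹ * postCov d lam sig μ x i j
          - (sig ^ 2)⁻¹ * (if i = j then 1 else 0)) := by
  have hlam0 : 0 < lam := hlam.1
  have hc : 0 < (2 * sig ^ 2)⁻¹ := by positivity
  have h2c : 2 * (2 * sig ^ 2)⁻¹ = (sig ^ 2)⁻¹ := by field_simp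
  have hpos := dens_pos (lam := lam) hsig μ
  obtain ⟨K, hK⟩ : ∃ K : ℝ, K = (2 * π * sig ^ 2) ^ (-(d : ℝ) / 2) := ⟨_, rfl⟩
  have hKt : Function.HasTemperateGrowth (fun _ : EuclideanSpace ℝ (Fin d) => K) := .const K
  have hfe : smoothedDensity d lam sig μ = gI (2 * sig ^ 2)⁻¹ lam μ (fun _ => K) := by
    rw [dens_eq, hK]
  have hf1 : ∀ x, HasFDerivAt (smoothedDensity d lam sig μ)
      (gI (2 * sig ^ 2)⁻¹ lam μ (gD (2 * sig ^ 2)⁻¹ (fun _ => K)) x) x := fun x => by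
    rw [hfe]; exact gI_hasFDerivAt hc lam μ hKt x
  have hf2 := gI_hasFDerivAt hc lam μ (temperate_gD (2 * sig ^ 2)⁻¹ hKt)
  have hl : ∀ x, HasFDerivAt (fun x => Real.log (smoothedDensity d lam sig μ x))
      ((smoothedDensity d lam sig μ x)⁻¹ •
        gI (2 * sig ^ 2)⁻¹ lam μ (gD (2 * sig ^ 2)⁻¹ (fun _ => K)) x) x :=
    fun x => (hf1 x).log (hpos x).ne'
  refine ⟨?_, hpos, fun x => ?_, fun x i j => ?_⟩
  · rw [hfe]
    exact contDiff_infty.2 fun n => gI_contDiff hc lam μ n hKt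
  · refine HasGradientAt.gradient ?_
    rw [hasGradientAt_iff_hasFDerivAt]
    refine (hl x).congr_fderiv ?_
    ext1 w
    have hm := mean_inner hlam0 hsig μ x w
    rw [← hK] at hm
    rw [smul_apply, gI_gD_apply hc, InnerProductSpace.toDual_apply_apply, inner_smul_left,
      inner_sub_left, inner_smul_left, conj_trivial, conj_trivial, hm, h2c, smul_eq_mul]
    ring
  · have hfd : fderiv ℝ (fun x => Real.log (smoothedDensity d lam sig μ x)) = fun x =>
        ((smoothedDensity d lam sig μ x)⁻¹ •
        gI (2 * sig ^ 2)⁻¹ lam μ (gD (2 * sig ^ 2)⁻¹ (fun _ => K)) x) :=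
      funext fun x => (hl x).fderiv
    have hinv := (hasDerivAt_inv (hpos x).ne').comp_hasFDerivAt x (hf1 x)
    have h2 := hinv.smul (hf2 x)
    have hcov := cov_eq hlam0 hsig μ x i j K hK _ _ rfl rfl
    have hij : inner ℝ (EuclideanSpace.single i (1 : ℝ)) (EuclideanSpace.single j (1 : ℝ))
        = if i = j then (1 : ℝ) else 0 := by
      rw [EuclideanSpace.inner_single_right]; simp [Pi.single_apply, eq_comm]
    have hp := hpos x
    rw [iteratedFDeriv_two_apply, hfd]
    refine (congrArg (fun L => L (EuclideanSpace.single i 1) (EuclideanSpace.single j 1))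
      h2.fderiv).trans ?_
    simp only [Matrix.cons_val_zero, Matrix.cons_val_one, add_apply, smul_apply,
      ContinuousLinearMap.smulRight_apply, Function.comp_apply, smul_eq_mul,
      gI_gD_apply hc, gI_gD_gD_apply hc, hij, h2c, ← hfe]
    have e : lam ^ 2 * (sig ^ 4)⁻¹ * postCov d lam sig μ x i j
        = (sig ^ 4)⁻¹ * (lam ^ 2 * postCov d lam sig μ x i j) := by ring
    rw [e, hcov]
    clear e hcov h2 hinv
    generalize gI (2 * sig ^ 2)⁻¹ lam μ (fun u => K * inner ℝ u (EuclideanSpace.single i 1) *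
      inner ℝ u (EuclideanSpace.single j 1)) x = D
    generalize gI (2 * sig ^ 2)⁻¹ lam μ (fun u => K * inner ℝ u (EuclideanSpace.single i 1)) x = A
    generalize gI (2 * sig ^ 2)⁻¹ lam μ (fun u => K * inner ℝ u (EuclideanSpace.single j 1)) x = B
    generalize smoothedDensity d lam sig μ x = f at hp ⊢
    generalize (if i = j then (1 : ℝ) else 0) = δ
    field_simp
    ring
end

section
/- Let μ and ν be probability measures on ℝ^d, both supported in the closed Euclidean ball of radius R > 0 centered at the origin, let λ ∈ (0, 1] and σ > 0, and let f_μ, f_ν be their Gaussian-smoothed densities. Then for every x ∈ ℝ^d: (1) ‖∇ log f_ν(x) − ∇ log f_μ(x)‖₂ ≤ 2 λ σ^{−2} R, and (2) Tr( ∇² log f_ν(x) − ∇² log f_μ(x) ) ≤ 2 λ² σ^{−4} R². -/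
open MeasureTheory Real

/-- The trace of the Hessian of `f : ℝ^d → ℝ` at `x`. -/
noncomputable def hessTrace {d : ℕ} (f : EuclideanSpace ℝ (Fin d) → ℝ)
    (x : EuclideanSpace ℝ (Fin d)) : ℝ :=
  ∑ i, iteratedFDeriv ℝ 2 f x ![EuclideanSpace.single i 1, EuclideanSpace.single i 1]

open scoped RealInnerProductSpace

section aux
variable {d : ℕ} {F : Type*} [NormedAddCommGroup F] [NormedSpace ℝ F]

lemma aux_exp_le (a R M : ℝ) (hR : 0 < R) (ha : 0 ≤ a) (z x : EuclideanSpace ℝ (Fin d))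
    (hz : ‖z‖ ≤ R) (hx : ‖x‖ ≤ M) :
    Real.exp (a * ⟪z, x⟫) ≤ Real.exp (a * (R * M)) := by
  apply Real.exp_le_exp.2
  apply mul_le_mul_of_nonneg_left _ ha
  exact (real_inner_le_norm z x).trans (mul_le_mul hz hx (norm_nonneg _) hR.le)

lemma aux_integrable (R : ℝ) (hR : 0 < R) (μ : Measure (EuclideanSpace ℝ (Fin d)))
    [IsProbabilityMeasure μ] (hμ : ∀ᵐ z ∂μ, ‖z‖ ≤ R) (a : ℝ) (ha : 0 ≤ a)
    (h : EuclideanSpace ℝ (Fin d) → F) (hc : Continuous h) (K : ℝ)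
    (hK : ∀ z, ‖z‖ ≤ R → ‖h z‖ ≤ K) (x : EuclideanSpace ℝ (Fin d)) :
    Integrable (fun z => Real.exp (a * ⟪z, x⟫) • h z) μ := by
  refine Integrable.of_bound (C := Real.exp (a * (R * ‖x‖)) * K) ?_ ?_
  · exact Continuous.aestronglyMeasurable (by fun_prop)
  · filter_upwards [hμ] with z hz
    rw [norm_smul, Real.norm_eq_abs, abs_of_pos (Real.exp_pos _)]
    exact mul_le_mul (aux_exp_le a R _ hR ha z x hz le_rfl) (hK z hz) (norm_nonneg _)
      (Real.exp_pos _).le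

lemma aux_cont_smulRight (a : ℝ) (h : EuclideanSpace ℝ (Fin d) → F) (hc : Continuous h) :
    Continuous (fun z : EuclideanSpace ℝ (Fin d) => (a • innerSL ℝ z).smulRight (h z)) := by
  have : (fun z : EuclideanSpace ℝ (Fin d) => (a • innerSL ℝ z).smulRight (h z)) =
    fun z => ContinuousLinearMap.smulRightL ℝ (EuclideanSpace ℝ (Fin d)) F
      (a • innerSL ℝ z) (h z) := by
    ext; simp [mul_smul]
  rw [this]
  fun_prop

lemma aux_norm_smulRight (a R : ℝ) (ha : 0 ≤ a) (hR : 0 < R) (v : F) (K : ℝ)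
    (z : EuclideanSpace ℝ (Fin d)) (hz : ‖z‖ ≤ R) (hv : ‖v‖ ≤ K) :
    ‖(a • innerSL ℝ z).smulRight v‖ ≤ a * R * K := by
  rw [ContinuousLinearMap.norm_smulRight_apply, norm_smul, innerSL_apply_norm, Real.norm_eq_abs,
    abs_of_nonneg ha]
  gcongr

lemma aux_hasFDerivAt (R : ℝ) (hR : 0 < R) (μ : Measure (EuclideanSpace ℝ (Fin d)))
    [IsProbabilityMeasure μ] (hμ : ∀ᵐ z ∂μ, ‖z‖ ≤ R) (a : ℝ) (ha : 0 ≤ a)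
    (h : EuclideanSpace ℝ (Fin d) → F) (hc : Continuous h) (K : ℝ)
    (hK : ∀ z, ‖z‖ ≤ R → ‖h z‖ ≤ K) (x : EuclideanSpace ℝ (Fin d)) :
    HasFDerivAt (fun x => ∫ z, Real.exp (a * ⟪z, x⟫) • h z ∂μ)
      (∫ z, Real.exp (a * ⟪z, x⟫) • (a • innerSL ℝ z).smulRight (h z) ∂μ) x := by
  have hc2 := aux_cont_smulRight a h hc
  refine hasFDerivAt_integral_of_dominated_of_fderiv_le (𝕜 := ℝ)
    (F' := fun x z => Real.exp (a * ⟪z, x⟫) • (a • innerSL ℝ z).smulRight (h z))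
    (bound := fun _ => Real.exp (a * (R * (‖x‖ + 1))) * (a * R * K))
    (Metric.ball_mem_nhds x one_pos) ?_ (aux_integrable R hR μ hμ a ha h hc K hK x) ?_ ?_
    (integrable_const _) ?_
  · exact Filter.Eventually.of_forall fun y =>
      (aux_integrable R hR μ hμ a ha h hc K hK y).aestronglyMeasurable
  · exact Continuous.aestronglyMeasurable (by fun_prop)
  · filter_upwards [hμ] with z hz y hy
    rw [norm_smul, Real.norm_eq_abs, abs_of_pos (Real.exp_pos _)]
    have hy' : ‖y‖ ≤ ‖x‖ + 1 := by
      have h1 : ‖y - x‖ < 1 := by simpa [dist_eq_norm] using hy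
      have h2 := norm_le_norm_add_norm_sub' y x
      linarith
    exact mul_le_mul (aux_exp_le a R _ hR ha z y hz hy')
      (aux_norm_smulRight a R ha hR (h z) K z hz (hK z hz)) (norm_nonneg _) (Real.exp_pos _).le
  · filter_upwards with z y _
    have h1 : HasFDerivAt (fun y : EuclideanSpace ℝ (Fin d) => a * ⟪z, y⟫) (a • innerSL ℝ z) y :=
      (innerSL ℝ z).hasFDerivAt.const_mul a
    have h2 := h1.exp.smul_const (h z)
    convert h2 using 1
    ext v
    simp [smul_smul, mul_assoc]

lemma aux_key (R : ℝ) (hR : 0 < R) (μ : Measure (EuclideanSpace ℝ (Fin d)))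
    [IsProbabilityMeasure μ] (hμ : ∀ᵐ z ∂μ, ‖z‖ ≤ R) (a b : ℝ) (ha : 0 ≤ a) (hb : 0 ≤ b) :
    ∃ (G : EuclideanSpace ℝ (Fin d) → ℝ)
      (P : EuclideanSpace ℝ (Fin d) → EuclideanSpace ℝ (Fin d) →L[ℝ] ℝ),
      (∀ x, G x = ∫ z, Real.exp (a * ⟪z, x⟫) • Real.exp (-(b * ‖z‖ ^ 2)) ∂μ) ∧ (∀ x, 0 < G x) ∧
      (∀ x, HasFDerivAt (fun x => Real.log (G x)) (P x) x) ∧ (∀ x, ‖P x‖ ≤ a * R) ∧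
      ∀ x, ∃ P' : EuclideanSpace ℝ (Fin d) →L[ℝ] EuclideanSpace ℝ (Fin d) →L[ℝ] ℝ,
        HasFDerivAt P P' x ∧
        -(a * R) ^ 2 ≤ ∑ i, P' (EuclideanSpace.single i 1) (EuclideanSpace.single i 1) ∧
        ∑ i, P' (EuclideanSpace.single i 1) (EuclideanSpace.single i 1) ≤ (a * R) ^ 2 := by
  set w : EuclideanSpace ℝ (Fin d) → ℝ := fun z => Real.exp (-(b * ‖z‖ ^ 2)) with hw
  have hwc : Continuous w := by fun_prop
  have hw0 : ∀ z, 0 < w z := fun z => Real.exp_pos _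
  have hw1 : ∀ z, ‖z‖ ≤ R → ‖w z‖ ≤ 1 := by
    intro z _
    rw [Real.norm_eq_abs, abs_of_pos (hw0 z), hw]
    apply Real.exp_le_one_iff.2
    have : 0 ≤ b * ‖z‖ ^ 2 := by positivity
    linarith
  set h1 : EuclideanSpace ℝ (Fin d) → EuclideanSpace ℝ (Fin d) →L[ℝ] ℝ :=
    fun z => (a • innerSL ℝ z).smulRight (w z) with hh1
  have h1c : Continuous h1 := aux_cont_smulRight a w hwc
  have h1b : ∀ z, ‖z‖ ≤ R → ‖h1 z‖ ≤ a * R * 1 := fun z hz =>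
    aux_norm_smulRight a R ha hR (w z) 1 z hz (hw1 z hz)
  set h2 : EuclideanSpace ℝ (Fin d) →
      EuclideanSpace ℝ (Fin d) →L[ℝ] EuclideanSpace ℝ (Fin d) →L[ℝ] ℝ :=
    fun z => (a • innerSL ℝ z).smulRight (h1 z) with hh2
  have h2c : Continuous h2 := aux_cont_smulRight a h1 h1c
  have h2b : ∀ z, ‖z‖ ≤ R → ‖h2 z‖ ≤ a * R * (a * R * 1) := fun z hz =>
    aux_norm_smulRight a R ha hR (h1 z) _ z hz (h1b z hz)
  set G : EuclideanSpace ℝ (Fin d) → ℝ := fun x => ∫ z, Real.exp (a * ⟪z, x⟫) • w z ∂μ with hG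
  set D := fun x => ∫ z, Real.exp (a * ⟪z, x⟫) • h1 z ∂μ with hD
  set D' := fun x => ∫ z, Real.exp (a * ⟪z, x⟫) • h2 z ∂μ with hD'
  have iG := aux_integrable R hR μ hμ a ha w hwc 1 hw1
  have iD := aux_integrable R hR μ hμ a ha h1 h1c _ h1b
  have iD' := aux_integrable R hR μ hμ a ha h2 h2c _ h2b
  have dG : ∀ x, HasFDerivAt G (D x) x := aux_hasFDerivAt R hR μ hμ a ha w hwc 1 hw1
  have dD : ∀ x, HasFDerivAt D (D' x) x := aux_hasFDerivAt R hR μ hμ a ha h1 h1c _ h1b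
  have G0 : ∀ x, 0 < G x := by
    intro x
    rw [hG]
    apply (integral_pos_iff_support_of_nonneg _ (iG x)).2
    · have : Function.support (fun z => Real.exp (a * ⟪z, x⟫) • w z) = Set.univ := by
        ext z
        simp [(hw0 z).ne']
      rw [this]; simp
    · intro z
      exact (mul_pos (Real.exp_pos _) (hw0 z)).le
  have Dle : ∀ x, ‖D x‖ ≤ a * R * G x := by
    intro x
    rw [hD, hG]
    simp only
    rw [← integral_const_mul]
    apply norm_integral_le_of_norm_le ((iG x).const_mul _)
    filter_upwards [hμ] with z hz
    rw [norm_smul, Real.norm_eq_abs, abs_of_pos (Real.exp_pos _), smul_eq_mul]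
    have := aux_norm_smulRight a R ha hR (w z) (w z) z hz (by
      rw [Real.norm_eq_abs, abs_of_pos (hw0 z)])
    calc _ ≤ Real.exp (a * ⟪z, x⟫) * (a * R * w z) := by gcongr
      _ = _ := by ring
  have Ple : ∀ x, ‖(G x)⁻¹ • D x‖ ≤ a * R := by
    intro x
    rw [norm_smul, norm_inv, Real.norm_eq_abs, abs_of_pos (G0 x), inv_mul_le_iff₀ (G0 x)]
    linarith [Dle x]
  refine ⟨G, fun x => (G x)⁻¹ • D x, fun x => rfl, G0, fun x => (dG x).log (G0 x).ne', Ple, ?_⟩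
  intro x
  have dinv : HasFDerivAt (fun y => (G y)⁻¹) (-((G x ^ 2)⁻¹ • D x)) x := by
    have := (hasDerivAt_inv (G0 x).ne').comp_hasFDerivAt x (dG x)
    refine this.congr_fderiv ?_
    rw [neg_smul]
  refine ⟨_, dinv.smul (dD x), ?_⟩
  have hsum : ∀ L : EuclideanSpace ℝ (Fin d) →L[ℝ] ℝ,
      ∑ i, (L (EuclideanSpace.single i 1)) ^ 2 = ‖L‖ ^ 2 := by
    intro L
    obtain ⟨v, rfl⟩ := (InnerProductSpace.toDual ℝ (EuclideanSpace ℝ (Fin d))).surjective L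
    rw [LinearIsometryEquiv.norm_map, EuclideanSpace.norm_sq_eq]
    apply Finset.sum_congr rfl
    intro i _
    simp [EuclideanSpace.inner_single_right]
  have hD'e : ∀ e, D' x e e = ∫ z, Real.exp (a * ⟪z, x⟫) * (a ^ 2 * ⟪z, e⟫ ^ 2 * w z) ∂μ := by
    intro e
    rw [hD']
    simp only
    rw [ContinuousLinearMap.integral_apply (iD' x),
      ContinuousLinearMap.integral_apply ((iD' x).apply_continuousLinearMap e)]
    congr 1
    ext z
    simp [hh2, hh1]
    ring
  have hz2 : ∀ z : EuclideanSpace ℝ (Fin d),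
      ∑ i, ⟪z, EuclideanSpace.single i (1:ℝ)⟫ ^ 2 = ‖z‖ ^ 2 := by
    intro z
    simpa using hsum (innerSL ℝ z)
  have hintegr : ∀ e, Integrable (fun z => Real.exp (a * ⟪z, x⟫) * (a ^ 2 * ⟪z, e⟫ ^ 2 * w z)) μ := by
    intro e
    have := ((iD' x).apply_continuousLinearMap e).apply_continuousLinearMap e
    convert this using 1
    ext z
    simp [hh2, hh1]
    ring
  have hT : ∑ i, D' x (EuclideanSpace.single i 1) (EuclideanSpace.single i 1) =
      ∫ z, Real.exp (a * ⟪z, x⟫) * (a ^ 2 * ‖z‖ ^ 2 * w z) ∂μ := by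
    simp_rw [hD'e]
    rw [← integral_finsetSum _ (fun i _ => hintegr _)]
    congr 1
    ext z
    rw [← hz2 z, ← Finset.mul_sum, ← Finset.sum_mul, ← Finset.mul_sum]
  have hT0 : 0 ≤ ∑ i, D' x (EuclideanSpace.single i 1) (EuclideanSpace.single i 1) := by
    rw [hT]
    apply integral_nonneg
    intro z
    have := (hw0 z).le
    positivity
  have hT1 : ∑ i, D' x (EuclideanSpace.single i 1) (EuclideanSpace.single i 1) ≤
      (a * R) ^ 2 * G x := by
    rw [hT, hG]
    simp only
    rw [← integral_const_mul]
    apply integral_mono_of_nonneg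
    · filter_upwards with z
      have := (hw0 z).le
      positivity
    · exact (iG x).const_mul _
    · filter_upwards [hμ] with z hz
      have := (hw0 z).le
      calc _ ≤ Real.exp (a * ⟪z, x⟫) * (a ^ 2 * R ^ 2 * w z) := by gcongr
        _ = _ := by rw [smul_eq_mul]; ring
  have hS : ∑ i, ((G x)⁻¹ • D' x + (-((G x ^ 2)⁻¹ • D x)).smulRight (D x))
        (EuclideanSpace.single i 1) (EuclideanSpace.single i 1) =
      (G x)⁻¹ * ∑ i, D' x (EuclideanSpace.single i 1) (EuclideanSpace.single i 1)
        - ‖(G x)⁻¹ • D x‖ ^ 2 := by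
    rw [← hsum, Finset.mul_sum, ← Finset.sum_sub_distrib]
    apply Finset.sum_congr rfl
    intro i _
    simp
    ring
  rw [hS]
  have hg := G0 x
  have hP2 : ‖(G x)⁻¹ • D x‖ ^ 2 ≤ (a * R) ^ 2 := by
    have := Ple x
    gcongr
  have hA : 0 ≤ (G x)⁻¹ * ∑ i, D' x (EuclideanSpace.single i 1) (EuclideanSpace.single i 1) := by
    positivity
  have hB : (G x)⁻¹ * ∑ i, D' x (EuclideanSpace.single i 1) (EuclideanSpace.single i 1)
      ≤ (a * R) ^ 2 := by
    rw [inv_mul_le_iff₀ hg]; linarith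
  constructor
  · linarith
  · linarith [sq_nonneg ‖(G x)⁻¹ • D x‖]

lemma aux_main (R : ℝ) (hR : 0 < R) (μ : Measure (EuclideanSpace ℝ (Fin d)))
    [IsProbabilityMeasure μ] (hμ : ∀ᵐ z ∂μ, ‖z‖ ≤ R) (lam sig : ℝ) (hlam : 0 < lam)
    (hsig : 0 < sig) (x : EuclideanSpace ℝ (Fin d)) :
    (∃ p : EuclideanSpace ℝ (Fin d) →L[ℝ] ℝ, ‖p‖ ≤ lam / sig ^ 2 * R ∧
      fderiv ℝ (fun x => Real.log (smoothedDensity d lam sig μ x)) x =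
        p - (sig ^ 2)⁻¹ • innerSL ℝ x) ∧
    ∃ T : ℝ, -(lam / sig ^ 2 * R) ^ 2 ≤ T ∧ T ≤ (lam / sig ^ 2 * R) ^ 2 ∧
      hessTrace (fun x => Real.log (smoothedDensity d lam sig μ x)) x =
        T - (sig ^ 2)⁻¹ * d := by
  obtain ⟨G, P, hG, G0, hP, Ple, hP'⟩ := aux_key R hR μ hμ (lam / sig ^ 2)
    (lam ^ 2 / (2 * sig ^ 2)) (by positivity) (by positivity)
  set C : ℝ := (2 * π * sig ^ 2) ^ (-(d : ℝ) / 2) with hC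
  have hC0 : 0 < C := by positivity
  have hf : (fun x => Real.log (smoothedDensity d lam sig μ x)) =
      fun x => Real.log C + (Real.log (G x) - (2 * sig ^ 2)⁻¹ * ‖x‖ ^ 2) := by
    ext y
    have : smoothedDensity d lam sig μ y =
        C * (G y * Real.exp (-((2 * sig ^ 2)⁻¹ * ‖y‖ ^ 2))) := by
      rw [smoothedDensity, hG, ← integral_mul_const, ← integral_const_mul]
      congr 1
      ext z
      rw [gaussKernel, smul_eq_mul, ← Real.exp_add, ← Real.exp_add]
      congr 2
      rw [norm_sub_sq_real, inner_smul_right, norm_smul, real_inner_comm, mul_pow,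
        Real.norm_eq_abs, sq_abs]
      field_simp
      ring
    rw [this, Real.log_mul hC0.ne' (mul_pos (G0 y) (Real.exp_pos _)).ne',
      Real.log_mul (G0 y).ne' (Real.exp_pos _).ne', Real.log_exp]
    ring
  have hd : ∀ y, HasFDerivAt (fun x => Real.log (smoothedDensity d lam sig μ x))
      (P y - (sig ^ 2)⁻¹ • innerSL ℝ y) y := by
    intro y
    rw [hf]
    have h1 := ((hP y).sub (((hasStrictFDerivAt_norm_sq y).hasFDerivAt).const_mul
      (2 * sig ^ 2)⁻¹)).const_add (Real.log C)
    refine h1.congr_fderiv ?_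
    ext v
    simp
    ring
  have hfd : fderiv ℝ (fun x => Real.log (smoothedDensity d lam sig μ x)) =
      fun y => P y - (sig ^ 2)⁻¹ • innerSL ℝ y := by
    ext1 y
    exact (hd y).fderiv
  refine ⟨⟨P x, Ple x, (hd x).fderiv⟩, ?_⟩
  obtain ⟨P', hP'd, hlo, hup⟩ := hP' x
  refine ⟨_, hlo, hup, ?_⟩
  obtain ⟨I, hI⟩ : ∃ I : EuclideanSpace ℝ (Fin d) →L[ℝ] EuclideanSpace ℝ (Fin d) →L[ℝ] ℝ,
      ∀ y, I y = innerSL ℝ y := ⟨innerSL ℝ, fun _ => rfl⟩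
  have hdd : HasFDerivAt (fun y => P y - (sig ^ 2)⁻¹ • innerSL ℝ y) (P' - (sig ^ 2)⁻¹ • I) x := by
    simp_rw [← hI]
    exact hP'd.sub ((sig ^ 2)⁻¹ • I).hasFDerivAt
  unfold hessTrace
  simp_rw [iteratedFDeriv_two_apply]
  rw [hfd, hdd.fderiv]
  simp [Finset.sum_sub_distrib, hI, mul_comm]

end aux

theorem stmt6 (d : ℕ) (R : ℝ) (hR : 0 < R)
    (μ ν : Measure (EuclideanSpace ℝ (Fin d)))
    [IsProbabilityMeasure μ] [IsProbabilityMeasure ν]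
    (hμ : ∀ᵐ z ∂μ, ‖z‖ ≤ R) (hν : ∀ᵐ z ∂ν, ‖z‖ ≤ R)
    (lam sig : ℝ) (hlam : lam ∈ Set.Ioc (0 : ℝ) 1) (hsig : 0 < sig) :
    ∀ x : EuclideanSpace ℝ (Fin d),
      ‖gradient (fun x => Real.log (smoothedDensity d lam sig ν x)) x -
          gradient (fun x => Real.log (smoothedDensity d lam sig μ x)) x‖
        ≤ 2 * lam * (sig ^ 2)⁻¹ * R ∧
      hessTrace (fun x => Real.log (smoothedDensity d lam sig ν x)) x -
          hessTrace (fun x => Real.log (smoothedDensity d lam sig μ x)) x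
        ≤ 2 * lam ^ 2 * (sig ^ 4)⁻¹ * R ^ 2 := by
  intro x
  obtain ⟨⟨p, hp, hpe⟩, T, hT1, hT2, hTe⟩ := aux_main R hR μ hμ lam sig hlam.1 hsig x
  obtain ⟨⟨q, hq, hqe⟩, S, hS1, hS2, hSe⟩ := aux_main R hR ν hν lam sig hlam.1 hsig x
  constructor
  · unfold gradient
    rw [← map_sub, LinearIsometryEquiv.norm_map, hpe, hqe, sub_sub_sub_cancel_right]
    calc ‖q - p‖ ≤ ‖q‖ + ‖p‖ := norm_sub_le _ _
      _ ≤ lam / sig ^ 2 * R + lam / sig ^ 2 * R := add_le_add hq hp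
      _ = _ := by ring
  · rw [hTe, hSe]
    have : 2 * lam ^ 2 * (sig ^ 4)⁻¹ * R ^ 2 = 2 * (lam / sig ^ 2 * R) ^ 2 := by
      field_simp
    linarith
end

section
/- There exists a universal constant C > 0 (independent of d, μ, λ, σ, ε) with the following property. Let μ be a probability measure on ℝ^d, λ ∈ (0, 1], σ > 0, and let f_μ be the Gaussian-smoothed density of μ. Then for every ε ∈ (0, 1), the probability measure with density f_μ assigns mass at most ε to the set { x ∈ ℝ^d : |Tr( ∇² log f_μ(x) )| > C (d + log(1/ε)) / σ² }. -/
open MeasureTheory Real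

section helpers

variable {d : ℕ}

lemma integrable_shift {F : Type*} [NormedAddCommGroup F]
    (μ : Measure (EuclideanSpace ℝ (Fin d))) [IsProbabilityMeasure μ] (lam : ℝ)
    [SecondCountableTopologyEither (EuclideanSpace ℝ (Fin d)) F]
    (φ : EuclideanSpace ℝ (Fin d) → F) (hc : Continuous φ) (B : ℝ) (hB : ∀ y, ‖φ y‖ ≤ B)
    (x : EuclideanSpace ℝ (Fin d)) : Integrable (fun z => φ (x - lam • z)) μ := by
  refine Integrable.of_bound (C := B) ?_ (Filter.Eventually.of_forall fun z => hB _)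
  exact (hc.comp (by fun_prop : Continuous fun z : (EuclideanSpace ℝ (Fin d)) => x - lam • z)).aestronglyMeasurable

lemma hasFDerivAt_shift {F : Type*} [NormedAddCommGroup F] [NormedSpace ℝ F]
    (μ : Measure (EuclideanSpace ℝ (Fin d))) [IsProbabilityMeasure μ] (lam : ℝ)
    (φ : EuclideanSpace ℝ (Fin d) → F)
    (φ' : EuclideanSpace ℝ (Fin d) → EuclideanSpace ℝ (Fin d) →L[ℝ] F)
    (hφ : ∀ y, HasFDerivAt φ (φ' y) y) (hc : Continuous φ') (B B' : ℝ)
    (hB : ∀ y, ‖φ y‖ ≤ B) (hB' : ∀ y, ‖φ' y‖ ≤ B') (x : EuclideanSpace ℝ (Fin d)) :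
    HasFDerivAt (fun x => ∫ z, φ (x - lam • z) ∂μ) (∫ z, φ' (x - lam • z) ∂μ) x := by
  have hc0 : Continuous φ := continuous_iff_continuousAt.2 fun y => (hφ y).continuousAt
  refine hasFDerivAt_integral_of_dominated_of_fderiv_le (bound := fun _ => B')
    (F := fun x z => φ (x - lam • z)) (F' := fun x z => φ' (x - lam • z))
    (s := Set.univ) Filter.univ_mem
    (Filter.Eventually.of_forall fun x => ?_) ?_ ?_ ?_ ?_ ?_
  · exact (integrable_shift μ lam φ hc0 B hB x).aestronglyMeasurable
  · exact integrable_shift μ lam φ hc0 B hB x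
  · exact (integrable_shift μ lam φ' hc B' hB' x).aestronglyMeasurable
  · exact Filter.Eventually.of_forall fun z x _ => hB' _
  · exact integrable_const _
  · exact Filter.Eventually.of_forall fun z x _ => (hasFDerivAt_comp_sub _).2 (hφ _)

lemma generic_norm {V F : Type*} [NormedAddCommGroup V] [NormedSpace ℝ V]
    [NormedAddCommGroup F] [NormedSpace ℝ F] (a : ℝ) (L : V →L[ℝ] F) (l : V →L[ℝ] ℝ) (w : F) :
    ‖a • L + l.smulRight w‖ ≤ |a| * ‖L‖ + ‖l‖ * ‖w‖ := by
  refine (norm_add_le _ _).trans ?_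
  rw [norm_smul, ContinuousLinearMap.norm_smulRight_apply, Real.norm_eq_abs]

lemma generic_cont {X V F : Type*} [TopologicalSpace X] [NormedAddCommGroup V] [NormedSpace ℝ V]
    [NormedAddCommGroup F] [NormedSpace ℝ F] (a : X → ℝ) (L : V →L[ℝ] F) (l : X → V →L[ℝ] ℝ)
    (w : X → F) (ha : Continuous a) (hl : Continuous l) (hw : Continuous w) :
    Continuous fun x => a x • L + (l x).smulRight (w x) := by
  have A : Continuous fun x => a x • L := ha.smul continuous_const
  have B : Continuous fun x => (l x).smulRight (w x) :=
    (ContinuousLinearMap.smulRightL ℝ V F).continuous₂.comp (hl.prodMk hw)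
  exact A.add B

/-- The inner product as a bilinear map. -/
noncomputable def ipL (d : ℕ) :
    EuclideanSpace ℝ (Fin d) →L[ℝ] EuclideanSpace ℝ (Fin d) →L[ℝ] ℝ := innerSL ℝ

lemma ipL_apply (y v : EuclideanSpace ℝ (Fin d)) : ipL d y v = inner ℝ y v := rfl

lemma ipL_norm_apply (y : EuclideanSpace ℝ (Fin d)) : ‖ipL d y‖ = ‖y‖ :=
  innerSL_apply_norm ℝ y

lemma ipL_norm_le : ‖ipL d‖ ≤ 1 := norm_innerSL_le ℝ

/-- Gaussian profile. -/
noncomputable def gk (c s : ℝ) (y : EuclideanSpace ℝ (Fin d)) : ℝ :=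
  c * Real.exp (-(s / 2) * ‖y‖ ^ 2)

noncomputable def gk1 (c s : ℝ) (y : EuclideanSpace ℝ (Fin d)) :
    EuclideanSpace ℝ (Fin d) →L[ℝ] ℝ :=
  (-(s * gk c s y)) • ipL d y

noncomputable def gk2 (c s : ℝ) (y : EuclideanSpace ℝ (Fin d)) :
    EuclideanSpace ℝ (Fin d) →L[ℝ] EuclideanSpace ℝ (Fin d) →L[ℝ] ℝ :=
  (-(s * gk c s y)) • ipL d + ((-s) • gk1 c s y).smulRight (ipL d y)

lemma gk_cont (c s : ℝ) : Continuous (gk (d := d) c s) := by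
  unfold gk; fun_prop

lemma gk1_cont (c s : ℝ) : Continuous (gk1 (d := d) c s) := by
  unfold gk1
  exact (continuous_const.mul (gk_cont c s)).neg.smul (ipL d).continuous

lemma gk2_cont (c s : ℝ) : Continuous (gk2 (d := d) c s) := by
  unfold gk2
  have h1 := gk_cont (d := d) c s
  have h2 := gk1_cont (d := d) c s
  have h3 : Continuous fun y : (EuclideanSpace ℝ (Fin d)) => ipL d y := (ipL d).continuous
  exact generic_cont _ _ _ _ (continuous_const.mul h1).neg (h2.const_smul (-s)) h3

lemma gk_deriv (c s : ℝ) (y : EuclideanSpace ℝ (Fin d)) :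
    HasFDerivAt (gk c s) (gk1 c s y) y := by
  have h := ((((hasFDerivAt_id y).norm_sq).const_mul (-(s/2))).exp).const_mul c
  refine h.congr_fderiv ?_
  ext v
  simp [gk1, gk, ipL_apply]
  ring

lemma gk1_deriv (c s : ℝ) (y : EuclideanSpace ℝ (Fin d)) :
    HasFDerivAt (gk1 c s) (gk2 c s y) y := by
  have h := (((gk_deriv c s y).const_mul (s)).neg).smul ((ipL d).hasFDerivAt (x := y))
  refine h.congr_fderiv ?_
  ext v w
  simp [gk2]

lemma gk_pos {c s : ℝ} (hc : 0 < c) (y : EuclideanSpace ℝ (Fin d)) : 0 < gk c s y := by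
  unfold gk; positivity

lemma gk_le {c s : ℝ} (hc : 0 < c) (hs : 0 < s) (y : EuclideanSpace ℝ (Fin d)) :
    gk c s y ≤ c := by
  unfold gk
  have : Real.exp (-(s / 2) * ‖y‖ ^ 2) ≤ 1 := by
    rw [Real.exp_le_one_iff]
    have : 0 ≤ (s/2) * ‖y‖^2 := by positivity
    linarith
  nlinarith

lemma gk_sq_le {c s : ℝ} (hc : 0 < c) (y : EuclideanSpace ℝ (Fin d)) :
    s * ‖y‖ ^ 2 * gk c s y ≤ 2 * c := by
  unfold gk
  have h := Real.mul_exp_neg_le_exp_neg_one ((s / 2) * ‖y‖ ^ 2)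
  have h1 : Real.exp (-1) ≤ 1 := by rw [Real.exp_le_one_iff]; norm_num
  have h2 : (s / 2) * ‖y‖ ^ 2 * Real.exp (-(s / 2) * ‖y‖ ^ 2) ≤ 1 := by
    rw [neg_mul]; linarith
  nlinarith

lemma gk1_bound {c s : ℝ} (hc : 0 < c) (hs : 0 < s) (y : EuclideanSpace ℝ (Fin d)) :
    ‖gk1 c s y‖ ≤ s * c + 2 * c := by
  have h0 := gk_pos (s := s) hc y
  have h1 := gk_le hc hs y
  have h2 := gk_sq_le (s := s) hc y
  unfold gk1
  rw [norm_smul, ipL_norm_apply, norm_neg, Real.norm_of_nonneg (by positivity)]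
  have h3 : ‖y‖ ≤ 1 + ‖y‖ ^ 2 := by nlinarith [sq_nonneg (‖y‖ - 1)]
  calc s * gk c s y * ‖y‖ ≤ s * gk c s y * (1 + ‖y‖ ^ 2) := by gcongr
    _ = s * gk c s y + s * ‖y‖ ^ 2 * gk c s y := by ring
    _ ≤ _ := by gcongr

lemma gk2_bound {c s : ℝ} (hc : 0 < c) (hs : 0 < s) (y : EuclideanSpace ℝ (Fin d)) :
    ‖gk2 c s y‖ ≤ s * c + s * (2 * c) := by
  have h0 := gk_pos (s := s) hc y
  have h1 := gk_le hc hs y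
  have h2 := gk_sq_le (s := s) hc y
  unfold gk2
  refine (generic_norm _ _ _ _).trans (add_le_add ?_ ?_)
  · rw [abs_neg, abs_of_nonneg (by positivity)]
    have := ipL_norm_le (d := d)
    calc _ ≤ s * gk c s y * 1 := by gcongr
      _ ≤ _ := by rw [mul_one]; gcongr
  · rw [norm_smul]
    unfold gk1
    rw [norm_smul, ipL_norm_apply, norm_neg, norm_neg, Real.norm_of_nonneg hs.le,
      Real.norm_of_nonneg (by positivity)]
    calc _ = s * (s * ‖y‖ ^ 2 * gk c s y) := by ring
      _ ≤ _ := by gcongr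

lemma gk_coord_int (μ : Measure (EuclideanSpace ℝ (Fin d))) [IsProbabilityMeasure μ]
    (lam : ℝ) {c s : ℝ} (hc : 0 < c) (hs : 0 < s) (x : EuclideanSpace ℝ (Fin d)) :
    Integrable (fun z => gk c s (x - lam • z)) μ :=
  integrable_shift μ lam _ (gk_cont c s) c
    (fun y => by rw [Real.norm_of_nonneg (gk_pos hc y).le]; exact gk_le hc hs y) x

/-- The convolution -/
noncomputable def gf (μ : Measure (EuclideanSpace ℝ (Fin d))) (lam c s : ℝ)
    (x : EuclideanSpace ℝ (Fin d)) : ℝ := ∫ z, gk c s (x - lam • z) ∂μ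

lemma gf_pos (μ : Measure (EuclideanSpace ℝ (Fin d))) [IsProbabilityMeasure μ]
    (lam : ℝ) {c s : ℝ} (hc : 0 < c) (hs : 0 < s) (x : EuclideanSpace ℝ (Fin d)) :
    0 < gf μ lam c s x := by
  unfold gf
  rw [integral_pos_iff_support_of_nonneg (fun z => (gk_pos hc _).le)
    (gk_coord_int μ lam hc hs x)]
  have : (Function.support fun z => gk c s (x - lam • z)) = Set.univ := by
    ext z; simp [(gk_pos (s := s) hc (x - lam • z)).ne']
  rw [this]; simp

lemma gf_cont (μ : Measure (EuclideanSpace ℝ (Fin d))) [IsProbabilityMeasure μ]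
    (lam : ℝ) {c s : ℝ} (hc : 0 < c) (hs : 0 < s) : Continuous (gf μ lam c s) := by
  refine continuous_iff_continuousAt.2 fun x => HasFDerivAt.continuousAt
    (hasFDerivAt_shift μ lam _ _ (gk_deriv c s) (gk1_cont c s) c _ (fun y => ?_)
      (fun y => gk1_bound hc hs y) x)
  rw [Real.norm_of_nonneg (gk_pos hc y).le]; exact gk_le hc hs y

lemma hess_formula (μ : Measure (EuclideanSpace ℝ (Fin d))) [IsProbabilityMeasure μ]
    (lam : ℝ) {c s : ℝ} (hc : 0 < c) (hs : 0 < s) (x v : EuclideanSpace ℝ (Fin d)) :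
    iteratedFDeriv ℝ 2 (fun x => Real.log (gf μ lam c s x)) x ![v, v] =
      (gf μ lam c s x)⁻¹ * (∫ z, (s ^ 2 * (inner ℝ (x - lam • z) v) ^ 2 - s * ‖v‖ ^ 2) *
          gk c s (x - lam • z) ∂μ)
      - ((gf μ lam c s x)⁻¹ * s * ∫ z, inner ℝ (x - lam • z) v * gk c s (x - lam • z) ∂μ) ^ 2 := by
  have b0 : ∀ y : (EuclideanSpace ℝ (Fin d)), ‖gk c s y‖ ≤ c := fun y => by
    rw [Real.norm_of_nonneg (gk_pos hc y).le]; exact gk_le hc hs y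
  have b1 := fun y : (EuclideanSpace ℝ (Fin d)) => gk1_bound hc hs y
  have b2 := fun y : (EuclideanSpace ℝ (Fin d)) => gk2_bound hc hs y
  have D1 : ∀ x, HasFDerivAt (gf μ lam c s) (∫ z, gk1 c s (x - lam • z) ∂μ) x := fun x =>
    hasFDerivAt_shift μ lam _ _ (gk_deriv c s) (gk1_cont c s) _ _ b0 b1 x
  have D2 : HasFDerivAt (fun x => ∫ z, gk1 c s (x - lam • z) ∂μ)
      (∫ z, gk2 c s (x - lam • z) ∂μ) x :=
    hasFDerivAt_shift μ lam _ _ (gk1_deriv c s) (gk2_cont c s) _ _ b1 b2 x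
  have hpos := fun x => gf_pos μ lam hc hs x
  have hL : fderiv ℝ (fun x => Real.log (gf μ lam c s x)) =
      fun x => (gf μ lam c s x)⁻¹ • ∫ z, gk1 c s (x - lam • z) ∂μ := by
    funext x
    exact ((D1 x).log (hpos x).ne').fderiv
  rw [iteratedFDeriv_two_apply, hL]
  have hinv : HasFDerivAt (fun x => (gf μ lam c s x)⁻¹)
      ((-((gf μ lam c s x) ^ 2)⁻¹) • ∫ z, gk1 c s (x - lam • z) ∂μ) x :=
    (hasDerivAt_inv (hpos x).ne').comp_hasFDerivAt x (D1 x)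
  have D3 := hinv.smul D2
  have i1 := integrable_shift μ lam _ (gk1_cont c s) _ b1 x
  have i2 := integrable_shift (F := (EuclideanSpace ℝ (Fin d)) →L[ℝ] (EuclideanSpace ℝ (Fin d)) →L[ℝ] ℝ) μ lam (gk2 c s) (gk2_cont c s) _ b2 x
  have e1 : (∫ z, gk1 c s (x - lam • z) ∂μ) v =
      -(s * ∫ z, inner ℝ (x - lam • z) v * gk c s (x - lam • z) ∂μ) := by
    rw [ContinuousLinearMap.integral_apply i1, ← integral_const_mul, ← integral_neg]
    congr 1; funext z
    simp only [gk1, _root_.smul_apply, ipL_apply, smul_eq_mul]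
    ring
  have e2 : (∫ z, gk2 c s (x - lam • z) ∂μ) v v =
      ∫ z, (s ^ 2 * (inner ℝ (x - lam • z) v) ^ 2 - s * ‖v‖ ^ 2) *
          gk c s (x - lam • z) ∂μ := by
    rw [ContinuousLinearMap.integral_apply i2, ContinuousLinearMap.integral_apply (i2.apply_continuousLinearMap v)]
    congr 1; funext z
    simp only [gk2, gk1, _root_.smul_apply, ipL_apply, smul_eq_mul,
      _root_.add_apply, ContinuousLinearMap.smulRight_apply,
      real_inner_self_eq_norm_sq]
    ring
  have D3' : fderiv ℝ (fun x => (gf μ lam c s x)⁻¹ • ∫ z, gk1 c s (x - lam • z) ∂μ) x = _ :=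
    D3.fderiv
  rw [D3']
  simp only [Matrix.cons_val_zero, Matrix.cons_val_one, _root_.add_apply,
    _root_.smul_apply, ContinuousLinearMap.smulRight_apply, smul_eq_mul, e1, e2]
  have := (hpos x).ne'
  field_simp
  ring

/-- two-sided bound on the trace -/
lemma trace_bound (μ : Measure (EuclideanSpace ℝ (Fin d))) [IsProbabilityMeasure μ]
    (lam : ℝ) {c s : ℝ} (hc : 0 < c) (hs : 0 < s) (x : EuclideanSpace ℝ (Fin d)) :
    -(s * d) ≤ hessTrace (fun x => Real.log (gf μ lam c s x)) x ∧
    hessTrace (fun x => Real.log (gf μ lam c s x)) x ≤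
      s * ((gf μ lam c s x)⁻¹ * ∫ z, s * ‖x - lam • z‖ ^ 2 * gk c s (x - lam • z) ∂μ) := by
  have hpos := gf_pos μ lam hc hs x
  have i0 := gk_coord_int μ lam hc hs x
  have isq : Integrable (fun z => s * ‖x - lam • z‖ ^ 2 * gk c s (x - lam • z)) μ := by
    refine integrable_shift μ lam (fun y => s * ‖y‖ ^ 2 * gk c s y)
      ((by fun_prop : Continuous fun y : (EuclideanSpace ℝ (Fin d)) => s * ‖y‖ ^ 2).mul (gk_cont c s)) (2 * c) ?_ x
    intro y
    have := gk_pos (s := s) hc y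
    rw [Real.norm_of_nonneg (by positivity)]
    exact gk_sq_le hc y
  have ico : ∀ i, Integrable (fun z => (x - lam • z) i ^ 2 * gk c s (x - lam • z)) μ := by
    intro i
    refine integrable_shift μ lam (fun y => y i ^ 2 * gk c s y)
      ((by fun_prop : Continuous fun y : (EuclideanSpace ℝ (Fin d)) => y i ^ 2).mul (gk_cont c s)) (2 * c / s) ?_ x
    intro y
    have h0 := gk_pos (s := s) hc y
    rw [Real.norm_of_nonneg (by positivity), le_div_iff₀ hs]
    refine le_trans ?_ (gk_sq_le (s := s) hc y)
    have : y i ^ 2 ≤ ‖y‖ ^ 2 := by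
      rw [← sq_abs]
      have := PiLp.norm_apply_le y i
      rw [Real.norm_eq_abs] at this
      gcongr
    calc y i ^ 2 * gk c s y * s ≤ ‖y‖ ^ 2 * gk c s y * s := by gcongr
      _ = _ := by ring
  have ico1 : ∀ i, Integrable (fun z => (x - lam • z) i * gk c s (x - lam • z)) μ := by
    intro i
    refine Integrable.mono' ((ico i).add i0) ?_ (Filter.Eventually.of_forall fun z => ?_)
    · exact ((by fun_prop : Continuous fun z : (EuclideanSpace ℝ (Fin d)) => (x - lam • z) i).mul
        ((gk_cont c s).comp (by fun_prop : Continuous fun z : (EuclideanSpace ℝ (Fin d)) => x - lam • z))).aestronglyMeasurable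
    · have h0 := gk_pos (s := s) hc (x - lam • z)
      rw [norm_mul, Real.norm_of_nonneg h0.le, Pi.add_apply, Real.norm_eq_abs]
      have : |(x - lam • z) i| ≤ (x - lam • z) i ^ 2 + 1 := by
        rw [← sq_abs]; nlinarith [sq_nonneg (|(x - lam • z) i| - 1)]
      nlinarith
  set f := gf μ lam c s x with hf
  have hf' : ∫ z, gk c s (x - lam • z) ∂μ = f := rfl
  set S : Fin d → ℝ := fun i => ∫ z, (x - lam • z) i ^ 2 * gk c s (x - lam • z) ∂μ with hS
  set T : Fin d → ℝ := fun i => ∫ z, (x - lam • z) i * gk c s (x - lam • z) ∂μ with hT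
  have key : hessTrace (fun x => Real.log (gf μ lam c s x)) x =
      ∑ i, (f⁻¹ * (s ^ 2 * S i - s * f) - (f⁻¹ * s * T i) ^ 2) := by
    unfold hessTrace
    refine Finset.sum_congr rfl fun i _ => ?_
    rw [hess_formula μ lam hc hs]
    simp only [EuclideanSpace.inner_single_right, one_mul, conj_trivial, PiLp.norm_single,
      norm_one, one_pow, mul_one]
    congr 2
    simp_rw [sub_mul, mul_assoc]
    rw [integral_sub ((ico i).const_mul _) (i0.const_mul _), integral_const_mul,
      integral_const_mul, hf']
  have CS : ∀ i, T i ^ 2 ≤ f * S i := by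
    intro i
    have h : 0 ≤ ∫ z, ((x - lam • z) i - f⁻¹ * T i) ^ 2 * gk c s (x - lam • z) ∂μ :=
      integral_nonneg fun z => mul_nonneg (sq_nonneg _) (gk_pos hc _).le
    have e : ∫ z, ((x - lam • z) i - f⁻¹ * T i) ^ 2 * gk c s (x - lam • z) ∂μ =
        S i - 2 * (f⁻¹ * T i) * T i + (f⁻¹ * T i) ^ 2 * f := by
      generalize f⁻¹ * T i = m
      change _ = (∫ z, (x - lam • z) i ^ 2 * gk c s (x - lam • z) ∂μ)
        - 2 * m * (∫ z, (x - lam • z) i * gk c s (x - lam • z) ∂μ)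
        + m ^ 2 * ∫ z, gk c s (x - lam • z) ∂μ
      rw [← integral_const_mul, ← integral_const_mul, ← integral_sub (ico i) ((ico1 i).const_mul _),
        ← integral_add (by exact (ico i).sub ((ico1 i).const_mul _)) (i0.const_mul _)]
      congr 1; funext z
      ring
    rw [e] at h
    have h2 : 0 ≤ f * (S i - 2 * (f⁻¹ * T i) * T i + (f⁻¹ * T i) ^ 2 * f) := by positivity
    have h3 : f * (S i - 2 * (f⁻¹ * T i) * T i + (f⁻¹ * T i) ^ 2 * f) = f * S i - T i ^ 2 := by
      field_simp; ring
    linarith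
  have sumS : ∫ z, s * ‖x - lam • z‖ ^ 2 * gk c s (x - lam • z) ∂μ = s * ∑ i, S i := by
    rw [hS, ← integral_finsetSum _ (fun i _ => ico i), ← integral_const_mul]
    congr 1; funext z
    rw [EuclideanSpace.real_norm_sq_eq, ← Finset.sum_mul]
    ring
  rw [key, sumS]
  constructor
  · have : -(s * d) = ∑ i : Fin d, (-s) := by simp; ring
    rw [this]
    refine Finset.sum_le_sum fun i _ => ?_
    have h := CS i
    have : f⁻¹ * (s ^ 2 * S i - s * f) - (f⁻¹ * s * T i) ^ 2 + s =
      (s * f⁻¹) ^ 2 * (f * S i - T i ^ 2) := by field_simp; ring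
    have h2 : 0 ≤ (s * f⁻¹) ^ 2 * (f * S i - T i ^ 2) :=
      mul_nonneg (sq_nonneg _) (by linarith)
    linarith
  · rw [Finset.mul_sum, Finset.mul_sum, Finset.mul_sum]
    refine Finset.sum_le_sum fun i _ => ?_
    have : f⁻¹ * (s ^ 2 * S i - s * f) = s * (f⁻¹ * (s * S i)) - s := by field_simp
    rw [this]
    nlinarith [sq_nonneg (f⁻¹ * s * T i)]

/-- pointwise exponential (Jensen-type) bound -/
lemma jensen_bound (μ : Measure (EuclideanSpace ℝ (Fin d))) [IsProbabilityMeasure μ]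
    (lam : ℝ) {c s : ℝ} (hc : 0 < c) (hs : 0 < s) (x : EuclideanSpace ℝ (Fin d)) (a : ℝ)
    (h : 4 * a ≤ (gf μ lam c s x)⁻¹ * ∫ z, s * ‖x - lam • z‖ ^ 2 * gk c s (x - lam • z) ∂μ) :
    gf μ lam c s x ≤ Real.exp (-a) * gf μ lam c (s / 2) x := by
  have hpos := gf_pos μ lam hc hs x
  have i0 := gk_coord_int μ lam hc hs x
  have i1 := gk_coord_int μ lam hc (half_pos hs) x
  have isq : Integrable (fun z => s * ‖x - lam • z‖ ^ 2 * gk c s (x - lam • z)) μ := by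
    refine integrable_shift μ lam (fun y => s * ‖y‖ ^ 2 * gk c s y)
      ((by fun_prop : Continuous fun y : (EuclideanSpace ℝ (Fin d)) => s * ‖y‖ ^ 2).mul (gk_cont c s)) (2 * c) ?_ x
    intro y
    have := gk_pos (s := s) hc y
    rw [Real.norm_of_nonneg (by positivity)]
    exact gk_sq_le hc y
  have pt : ∀ y : (EuclideanSpace ℝ (Fin d)), (1 - a) * gk c s y + 4⁻¹ * (s * ‖y‖ ^ 2 * gk c s y) ≤
      Real.exp (-a) * gk c (s / 2) y := by
    intro y
    have h1 := Real.add_one_le_exp (s * ‖y‖ ^ 2 / 4 - a)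
    have h2 := gk_pos (s := s) hc y
    have h3 : Real.exp (-a) * gk c (s / 2) y = Real.exp (s * ‖y‖ ^ 2 / 4 - a) * gk c s y := by
      unfold gk
      rw [mul_left_comm, ← Real.exp_add, mul_left_comm (Real.exp _) c, ← Real.exp_add]
      congr 2; ring
    rw [h3]
    nlinarith
  have I := integral_mono ((i0.const_mul (1 - a)).add (isq.const_mul 4⁻¹))
    (i1.const_mul (Real.exp (-a))) (fun z => pt (x - lam • z))
  simp only [Pi.add_apply] at I
  rw [integral_add (i0.const_mul (1 - a)) (isq.const_mul 4⁻¹), integral_const_mul,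
    integral_const_mul, integral_const_mul] at I
  rw [inv_mul_eq_div, le_div_iff₀ hpos] at h
  unfold gf at *
  linarith

lemma total_mass (μ : Measure (EuclideanSpace ℝ (Fin d))) [IsProbabilityMeasure μ]
    (lam : ℝ) {c s : ℝ} (hc : 0 < c) (hs : 0 < s) :
    ∫⁻ x, ENNReal.ofReal (gf μ lam c s x) = ENNReal.ofReal (c * (2 * π / s) ^ ((d : ℝ) / 2)) := by
  have h1 : ∀ x, ENNReal.ofReal (gf μ lam c s x) =
      ∫⁻ z, ENNReal.ofReal (gk c s (x - lam • z)) ∂μ := fun x =>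
    ofReal_integral_eq_lintegral_ofReal (gk_coord_int μ lam hc hs x)
      (Filter.Eventually.of_forall fun z => (gk_pos hc _).le)
  simp_rw [h1]
  rw [lintegral_lintegral_swap]
  · have hG : ∫ v : (EuclideanSpace ℝ (Fin d)), gk c s v = c * (2 * π / s) ^ ((d : ℝ) / 2) := by
      unfold gk
      rw [integral_const_mul, GaussianFourier.integral_rexp_neg_mul_sq_norm (half_pos hs)]
      simp only [finrank_euclideanSpace, Fintype.card_fin]
      congr 2
      field_simp
    have hI : Integrable (fun v : (EuclideanSpace ℝ (Fin d)) => gk c s v) := by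
      by_contra hn
      rw [integral_undef hn] at hG
      have : 0 < c * (2 * π / s) ^ ((d : ℝ) / 2) := by positivity
      linarith
    have h2 : ∀ z : (EuclideanSpace ℝ (Fin d)), ∫⁻ x, ENNReal.ofReal (gk c s (x - lam • z)) =
        ENNReal.ofReal (c * (2 * π / s) ^ ((d : ℝ) / 2)) := by
      intro z
      rw [lintegral_sub_right_eq_self (fun v : (EuclideanSpace ℝ (Fin d)) => ENNReal.ofReal (gk c s v)) (lam • z), ← hG,
        ofReal_integral_eq_lintegral_ofReal hI
          (Filter.Eventually.of_forall fun z => (gk_pos hc _).le)]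
    simp_rw [h2]
    simp
  · exact (ENNReal.continuous_ofReal.comp ((gk_cont c s).comp
      (by fun_prop : Continuous fun p : (EuclideanSpace ℝ (Fin d)) × (EuclideanSpace ℝ (Fin d)) => p.1 - lam • p.2))).measurable.aemeasurable

end helpers

theorem stmt8 : ∃ C : ℝ, 0 < C ∧
    ∀ (d : ℕ) (μ : Measure (EuclideanSpace ℝ (Fin d))), IsProbabilityMeasure μ →
    ∀ lam sig : ℝ, lam ∈ Set.Ioc (0 : ℝ) 1 → 0 < sig →
    ∀ ε : ℝ, 0 < ε → ε < 1 →
      (volume.withDensity fun x => ENNReal.ofReal (smoothedDensity d lam sig μ x))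
        {x | C * ((d : ℝ) + Real.log (1 / ε)) / sig ^ 2 <
          |hessTrace (fun x => Real.log (smoothedDensity d lam sig μ x)) x|}
      ≤ ENNReal.ofReal ε := by
  refine ⟨4, by norm_num, ?_⟩
  intro d μ hμ lam sig hlam hsig ε hε hε1
  set c : ℝ := (2 * π * sig ^ 2) ^ (-(d : ℝ) / 2) with hc
  set s : ℝ := (sig ^ 2)⁻¹ with hs
  have hs0 : 0 < s := by positivity
  have hc0 : 0 < c := by positivity
  have hfeq : smoothedDensity d lam sig μ = gf μ lam c s := by
    funext x
    unfold smoothedDensity gf gk gaussKernel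
    congr 1; funext z
    congr 2
    rw [hs]; field_simp
  simp_rw [hfeq]
  set a : ℝ := (d : ℝ) + Real.log (1 / ε) with ha
  have hlog : 0 < Real.log (1 / ε) := Real.log_pos (by rw [lt_div_iff₀ hε]; linarith)
  rw [withDensity_apply']
  have hsub : ∀ x ∈ {x | 4 * a / sig ^ 2 <
      |hessTrace (fun x => Real.log (gf μ lam c s x)) x|},
      gf μ lam c s x ≤ Real.exp (-a) * gf μ lam c (s / 2) x := by
    intro x hx
    refine jensen_bound μ lam hc0 hs0 x a ?_
    obtain ⟨h1, h2⟩ := trace_bound μ lam hc0 hs0 x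
    have hx' : s * (4 * a) < |hessTrace (fun x => Real.log (gf μ lam c s x)) x| := by
      have : s * (4 * a) = 4 * a / sig ^ 2 := by rw [hs]; field_simp
      rw [this]; exact hx
    have hd : (0 : ℝ) ≤ d := Nat.cast_nonneg d
    rcases lt_abs.1 hx' with h | h
    · exact (lt_of_mul_lt_mul_left (h.trans_le h2) hs0.le).le
    · exfalso
      have : s * (4 * a) < s * d := by linarith
      have := lt_of_mul_lt_mul_left this hs0.le
      linarith
  calc ∫⁻ x in {x | 4 * a / sig ^ 2 < |hessTrace (fun x => Real.log (gf μ lam c s x)) x|},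
        ENNReal.ofReal (gf μ lam c s x)
      ≤ ∫⁻ x in {x | 4 * a / sig ^ 2 < |hessTrace (fun x => Real.log (gf μ lam c s x)) x|},
        ENNReal.ofReal (Real.exp (-a)) * ENNReal.ofReal (gf μ lam c (s / 2) x) := by
        have hmeas : Measurable fun x => ENNReal.ofReal (Real.exp (-a)) *
            ENNReal.ofReal (gf μ lam c (s / 2) x) := by
          exact (ENNReal.continuous_ofReal.comp
            (gf_cont μ lam hc0 (half_pos hs0))).measurable.const_mul _
        refine setLIntegral_mono hmeas fun x hx => ?_
        rw [← ENNReal.ofReal_mul (Real.exp_pos _).le]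
        exact ENNReal.ofReal_le_ofReal (hsub x hx)
    _ ≤ ∫⁻ x, ENNReal.ofReal (Real.exp (-a)) * ENNReal.ofReal (gf μ lam c (s / 2) x) :=
        setLIntegral_le_lintegral _ _
    _ = ENNReal.ofReal (Real.exp (-a)) * ENNReal.ofReal (c * (2 * π / (s / 2)) ^ ((d : ℝ) / 2)) := by
        rw [lintegral_const_mul' _ _ ENNReal.ofReal_ne_top, total_mass μ lam hc0 (half_pos hs0)]
    _ ≤ ENNReal.ofReal ε := by
        rw [← ENNReal.ofReal_mul (Real.exp_pos _).le]
        refine ENNReal.ofReal_le_ofReal ?_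
        have e1 : c * (2 * π / (s / 2)) ^ ((d : ℝ) / 2) = 2 ^ ((d : ℝ) / 2) := by
          have : 2 * π / (s / 2) = 2 * (2 * π * sig ^ 2) := by rw [hs]; field_simp
          rw [this, Real.mul_rpow (by norm_num) (by positivity), hc, mul_left_comm,
            ← Real.rpow_add (by positivity)]
          have : -(d : ℝ) / 2 + d / 2 = 0 := by ring
          rw [this]; simp
        have e2 : Real.exp (-a) = Real.exp (-(d : ℝ)) * ε := by
          rw [ha, neg_add, Real.exp_add, one_div, Real.log_inv, neg_neg, Real.exp_log hε]
        have e3 : (2 : ℝ) ^ ((d : ℝ) / 2) ≤ Real.exp d := by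
          rw [Real.rpow_def_of_pos (by norm_num)]
          apply Real.exp_le_exp.2
          have := Real.log_two_lt_d9
          have hd : (0 : ℝ) ≤ d := Nat.cast_nonneg d
          nlinarith
        rw [e1, e2]
        calc Real.exp (-(d : ℝ)) * ε * 2 ^ ((d : ℝ) / 2)
            ≤ Real.exp (-(d : ℝ)) * ε * Real.exp d := by gcongr
          _ = ε * (Real.exp (-(d : ℝ)) * Real.exp d) := by ring
          _ = ε := by rw [← Real.exp_add]; simp
end

section
/- Let μ be a probability measure on ℝ^d with finite second moment ∫ ‖z‖₂² dμ(z) < ∞, let λ ∈ (0, 1] and σ > 0, and let f_μ be the Gaussian-smoothed density of μ. Then ∫_{ℝ^d} ‖∇ log f_μ(x)‖₂² f_μ(x) dx = d/σ² − (λ²/σ⁴) ∫_{ℝ^d} Tr( Σ_μ(x) ) f_μ(x) dx ≤ d/σ², where Σ_μ(x) is the posterior covariance of μ at x. -/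
open MeasureTheory Real

open ProbabilityTheory in
lemma gk_prod (d : ℕ) (lam sig : ℝ) (hsig : 0 < sig) (x z : EuclideanSpace ℝ (Fin d)) :
    gaussKernel d lam sig x z
      = ∏ i, gaussianPDFReal 0 (Real.toNNReal (sig ^ 2)) ((x - lam • z) i) := by
  unfold gaussKernel
  have hs : 0 ≤ sig ^ 2 := by positivity
  simp only [gaussianPDFReal_def, Real.coe_toNNReal _ hs, Finset.prod_mul_distrib, ← Real.exp_sum, Finset.prod_const,
    Finset.card_univ, Fintype.card_fin]
  congr 1
  · rw [Real.sqrt_eq_rpow, ← Real.rpow_neg (by positivity), ← Real.rpow_natCast _ d,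
      ← Real.rpow_mul (by positivity)]
    congr 1
    ring
  · congr 1
    rw [EuclideanSpace.norm_sq_eq, ← Finset.sum_div, Finset.sum_neg_distrib]
    simp

open ProbabilityTheory in
lemma gauss_sq (sig : ℝ) (hsig : 0 < sig) :
    ∫ t, gaussianPDFReal 0 (Real.toNNReal (sig ^ 2)) t * t ^ 2 = sig ^ 2 := by
  have hv : Real.toNNReal (sig ^ 2) ≠ 0 := by
    simpa using hsig.ne'
  have h := variance_fun_id_gaussianReal (μ := 0) (v := Real.toNNReal (sig ^ 2))
  rw [variance_eq_integral measurable_id'.aemeasurable,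
    integral_gaussianReal_eq_integral_smul hv] at h
  simpa [sq_nonneg] using h

open ProbabilityTheory in
lemma gauss_coord (d : ℕ) (sig : ℝ) (hsig : 0 < sig) (i : Fin d) :
    ∫ y : EuclideanSpace ℝ (Fin d), gaussKernel d 0 sig y 0 * (y i) ^ 2 = sig ^ 2 := by
  have hv : Real.toNNReal (sig ^ 2) ≠ 0 := by
    simpa using hsig.ne'
  rw [← (PiLp.volume_preserving_toLp (Fin d)).integral_comp
    (MeasurableEquiv.toLp 2 _).measurableEmbedding]
  simp only [gk_prod _ _ _ hsig]
  have : ∀ x : Fin d → ℝ, (∏ j, gaussianPDFReal 0 (Real.toNNReal (sig ^ 2))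
      ((WithLp.toLp 2 x - (0:ℝ) • (0 : EuclideanSpace ℝ (Fin d))) j)) * (WithLp.toLp 2 x) i ^ 2
      = ∏ j, (fun j t => gaussianPDFReal 0 (Real.toNNReal (sig ^ 2)) t
          * (if j = i then t ^ 2 else 1)) j (x j) := by
    intro x
    simp only [Finset.prod_mul_distrib]
    simp
  simp only [this]
  rw [integral_fintype_prod_volume_eq_prod
    (fun (j : Fin d) (t : ℝ) => gaussianPDFReal 0 (Real.toNNReal (sig ^ 2)) t
          * (if j = i then t ^ 2 else 1)), Finset.prod_eq_single i]
  · simpa using gauss_sq sig hsig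
  · intro j _ hj
    simp [hj, integral_gaussianPDFReal_eq_one 0 hv]
  · simp

lemma gauss_norm (d : ℕ) (sig : ℝ) (hsig : 0 < sig) :
    Integrable (fun y : EuclideanSpace ℝ (Fin d) => gaussKernel d 0 sig y 0 * ‖y‖ ^ 2) ∧
    ∫ y : EuclideanSpace ℝ (Fin d), gaussKernel d 0 sig y 0 * ‖y‖ ^ 2 = d * sig ^ 2 := by
  have hi : ∀ i : Fin d, Integrable
      (fun y : EuclideanSpace ℝ (Fin d) => gaussKernel d 0 sig y 0 * (y i) ^ 2) := by
    intro i
    by_contra h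
    have h1 := gauss_coord d sig hsig i
    rw [integral_undef h] at h1
    have : 0 < sig ^ 2 := by positivity
    linarith
  have he : ∀ y : EuclideanSpace ℝ (Fin d), gaussKernel d 0 sig y 0 * ‖y‖ ^ 2
      = ∑ i, gaussKernel d 0 sig y 0 * (y i) ^ 2 := by
    intro y
    rw [EuclideanSpace.norm_sq_eq, Finset.mul_sum]
    simp
  simp only [he]
  refine ⟨integrable_finsetSum _ fun i _ => hi i, ?_⟩
  rw [integral_finsetSum _ fun i _ => hi i]
  simp [gauss_coord d sig hsig]

lemma gk_shift (d : ℕ) (lam sig : ℝ) (x z : EuclideanSpace ℝ (Fin d)) :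
    gaussKernel d lam sig x z = gaussKernel d 0 sig (x - lam • z) 0 := by
  simp [gaussKernel]

lemma gk_cont_s15 (d : ℕ) (lam sig : ℝ) :
    Continuous (fun p : EuclideanSpace ℝ (Fin d) × EuclideanSpace ℝ (Fin d) =>
      gaussKernel d lam sig p.1 p.2) := by
  unfold gaussKernel
  fun_prop

lemma gk_pos_s15 (d : ℕ) (lam sig : ℝ) (hsig : 0 < sig) (x z : EuclideanSpace ℝ (Fin d)) :
    0 < gaussKernel d lam sig x z := by
  unfold gaussKernel
  positivity

lemma gk_le_s15 (d : ℕ) (lam sig : ℝ) (hsig : 0 < sig) (x z : EuclideanSpace ℝ (Fin d)) :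
    gaussKernel d lam sig x z ≤ (2 * π * sig ^ 2) ^ (-(d : ℝ) / 2) := by
  unfold gaussKernel
  apply mul_le_of_le_one_right (by positivity)
  rw [Real.exp_le_one_iff]
  rw [neg_div]
  have : 0 ≤ ‖x - lam • z‖ ^ 2 / (2 * sig ^ 2) := by positivity
  linarith

lemma fubini (d : ℕ) (μ : Measure (EuclideanSpace ℝ (Fin d))) [IsProbabilityMeasure μ]
    (lam sig : ℝ) (hsig : 0 < sig) :
    Integrable (fun x => ∫ z, gaussKernel d lam sig x z * ‖x - lam • z‖ ^ 2 ∂μ) ∧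
    ∫ x, ∫ z, gaussKernel d lam sig x z * ‖x - lam • z‖ ^ 2 ∂μ = d * sig ^ 2 := by
  obtain ⟨h1, h2⟩ := gauss_norm d sig hsig
  have h1z : ∀ z, Integrable (fun x => gaussKernel d lam sig x z * ‖x - lam • z‖ ^ 2) := by
    intro z
    simp only [gk_shift d lam]
    exact h1.comp_sub_right (lam • z)
  have h2z : ∀ z, ∫ x, gaussKernel d lam sig x z * ‖x - lam • z‖ ^ 2 = d * sig ^ 2 := by
    intro z
    simp only [gk_shift d lam]
    rw [← h2]
    exact integral_sub_right_eq_self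
      (fun y : EuclideanSpace ℝ (Fin d) => gaussKernel d 0 sig y 0 * ‖y‖ ^ 2) (lam • z)
  have hint : Integrable (Function.uncurry fun x z =>
      gaussKernel d lam sig x z * ‖x - lam • z‖ ^ 2)
      ((volume : Measure (EuclideanSpace ℝ (Fin d))).prod μ) := by
    rw [integrable_prod_iff']
    · refine ⟨Filter.Eventually.of_forall h1z, ?_⟩
      have : ∀ z, ∫ x, ‖(Function.uncurry fun x z =>
          gaussKernel d lam sig x z * ‖x - lam • z‖ ^ 2) (x, z)‖ = d * sig ^ 2 := by
        intro z
        rw [← h2z z]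
        congr 1
        ext x
        simp only [Function.uncurry]
        rw [Real.norm_of_nonneg]
        have := gk_pos_s15 d lam sig hsig x z
        positivity
      simp only [this]
      exact integrable_const _
    · apply Continuous.aestronglyMeasurable
      have := gk_cont_s15 d lam sig
      simp only [Function.uncurry_def]
      fun_prop
  refine ⟨hint.integral_prod_left, ?_⟩
  rw [integral_integral_swap hint]
  simp [h2z]

lemma gk_hasFDeriv (d : ℕ) (lam sig : ℝ) (x z : EuclideanSpace ℝ (Fin d)) :
    HasFDerivAt (fun x => gaussKernel d lam sig x z)
      (innerSL ℝ ((gaussKernel d lam sig x z * (-(sig ^ 2)⁻¹)) • (x - lam • z))) x := by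
  unfold gaussKernel
  have h := ((((hasFDerivAt_id x).sub_const (lam • z)).norm_sq.neg.mul_const
    (2 * sig ^ 2)⁻¹).exp).const_mul ((2 * π * sig ^ 2) ^ (-(d : ℝ) / 2))
  refine h.congr_fderiv ?_
  ext v
  simp [div_eq_mul_inv]
  ring

lemma bound_aux (s t : ℝ) (hs : 0 < s) : Real.exp (-t ^ 2 / (2 * s ^ 2)) * t ≤ s := by
  have h := Real.add_one_le_exp (t ^ 2 / (2 * s ^ 2))
  have h2 : t ≤ s * Real.exp (t ^ 2 / (2 * s ^ 2)) := by
    have : t / s ≤ t ^ 2 / (2 * s ^ 2) + 1 := by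
      have e : t ^ 2 / (2 * s ^ 2) = (t / s) ^ 2 / 2 := by field_simp
      rw [e]
      nlinarith [sq_nonneg (t / s - 1)]
    calc t = s * (t / s) := by field_simp
      _ ≤ _ := by gcongr; linarith
  rw [neg_div, Real.exp_neg, inv_mul_le_iff₀ (Real.exp_pos _)]
  linarith

lemma gk_cont_right (d : ℕ) (lam sig : ℝ) (x : EuclideanSpace ℝ (Fin d)) :
    Continuous (fun z : EuclideanSpace ℝ (Fin d) => gaussKernel d lam sig x z) := by
  unfold gaussKernel
  fun_prop

lemma gk_integrable (d : ℕ) (μ : Measure (EuclideanSpace ℝ (Fin d))) [IsProbabilityMeasure μ]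
    (lam sig : ℝ) (hsig : 0 < sig) (x : EuclideanSpace ℝ (Fin d)) :
    Integrable (fun z => gaussKernel d lam sig x z) μ := by
  refine Integrable.of_bound (C := (2 * π * sig ^ 2) ^ (-(d : ℝ) / 2))
    (Continuous.aestronglyMeasurable ?_) ?_
  · exact gk_cont_right d lam sig x
  · refine Filter.Eventually.of_forall fun z => ?_
    rw [Real.norm_of_nonneg (gk_pos_s15 d lam sig hsig x z).le]
    exact gk_le_s15 d lam sig hsig x z

lemma sd_hasFDeriv (d : ℕ) (μ : Measure (EuclideanSpace ℝ (Fin d))) [IsProbabilityMeasure μ]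
    (lam sig : ℝ) (hsig : 0 < sig) (x : EuclideanSpace ℝ (Fin d)) :
    HasFDerivAt (smoothedDensity d lam sig μ)
      (∫ z, innerSL ℝ ((gaussKernel d lam sig x z * (-(sig ^ 2)⁻¹)) • (x - lam • z)) ∂μ) x := by
  refine hasFDerivAt_integral_of_dominated_of_fderiv_le
    (F := fun x z => gaussKernel d lam sig x z)
    (F' := fun x z => innerSL ℝ ((gaussKernel d lam sig x z * (-(sig ^ 2)⁻¹)) • (x - lam • z)))
    (bound := fun _ => (2 * π * sig ^ 2) ^ (-(d : ℝ) / 2) * (sig ^ 2)⁻¹ * sig)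
    (s := Set.univ) Filter.univ_mem ?_ ?_ ?_ ?_ (integrable_const _) ?_
  · exact Filter.Eventually.of_forall fun y => (gk_cont_right d lam sig y).aestronglyMeasurable
  · exact gk_integrable d μ lam sig hsig x
  · have h0 := gk_cont_right d lam sig x
    apply Continuous.aestronglyMeasurable
    exact (innerSL ℝ).continuous.comp (by fun_prop)
  · refine Filter.Eventually.of_forall fun z y _ => ?_
    rw [innerSL_apply_norm, norm_smul, norm_mul, Real.norm_of_nonneg (gk_pos_s15 d lam sig hsig y z).le,
      norm_neg, Real.norm_of_nonneg (by positivity : 0 ≤ (sig ^ 2)⁻¹)]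
    unfold gaussKernel
    have := bound_aux sig ‖y - lam • z‖ hsig
    calc _ = (2 * π * sig ^ 2) ^ (-(d : ℝ) / 2) * (sig ^ 2)⁻¹ *
          (Real.exp (-‖y - lam • z‖ ^ 2 / (2 * sig ^ 2)) * ‖y - lam • z‖) := by ring
      _ ≤ _ := by gcongr
  · exact Filter.Eventually.of_forall fun z y _ => gk_hasFDeriv d lam sig y z

lemma gk_mul_integrable (d : ℕ) (μ : Measure (EuclideanSpace ℝ (Fin d))) [IsProbabilityMeasure μ]
    (lam sig : ℝ) (hsig : 0 < sig) (x : EuclideanSpace ℝ (Fin d))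
    (g : EuclideanSpace ℝ (Fin d) → ℝ) (hg : Integrable g μ) :
    Integrable (fun z => gaussKernel d lam sig x z * g z) μ := by
  refine hg.bdd_mul (c := (2 * π * sig ^ 2) ^ (-(d : ℝ) / 2))
    (gk_integrable d μ lam sig hsig x).aestronglyMeasurable ?_
  refine Filter.Eventually.of_forall fun z => ?_
  rw [Real.norm_of_nonneg (gk_pos_s15 d lam sig hsig x z).le]
  exact gk_le_s15 d lam sig hsig x z

lemma sd_pos (d : ℕ) (μ : Measure (EuclideanSpace ℝ (Fin d))) [IsProbabilityMeasure μ]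
    (lam sig : ℝ) (hsig : 0 < sig) (x : EuclideanSpace ℝ (Fin d)) :
    0 < smoothedDensity d lam sig μ x := by
  unfold smoothedDensity
  rw [integral_pos_iff_support_of_nonneg (fun z => (gk_pos_s15 d lam sig hsig x z).le)
    (gk_integrable d μ lam sig hsig x)]
  have : Function.support (fun z => gaussKernel d lam sig x z) = Set.univ := by
    ext z
    simp [(gk_pos_s15 d lam sig hsig x z).ne']
  rw [this]
  simp

lemma coord_int (d : ℕ) (μ : Measure (EuclideanSpace ℝ (Fin d))) [IsProbabilityMeasure μ]
    (hmom : Integrable (fun z => ‖z‖ ^ 2) μ) (i : Fin d) :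
    Integrable (fun z : EuclideanSpace ℝ (Fin d) => z i) μ ∧
    Integrable (fun z : EuclideanSpace ℝ (Fin d) => z i ^ 2) μ := by
  have hb : ∀ z : EuclideanSpace ℝ (Fin d), z i ^ 2 ≤ ‖z‖ ^ 2 := by
    intro z
    have := PiLp.norm_apply_le z i
    rw [← sq_abs]
    rw [Real.norm_eq_abs] at this
    gcongr
  constructor
  · refine ((integrable_const (1 : ℝ)).add hmom).mono'
      (Continuous.aestronglyMeasurable (by fun_prop)) (Filter.Eventually.of_forall fun z => ?_)
    have := hb z
    simp only [Pi.add_apply, Real.norm_eq_abs]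
    rw [abs_le]
    constructor <;> nlinarith [sq_nonneg (z i - 1), sq_nonneg (z i + 1)]
  · refine hmom.mono'
      (Continuous.aestronglyMeasurable (by fun_prop)) (Filter.Eventually.of_forall fun z => ?_)
    rw [Real.norm_of_nonneg (sq_nonneg _)]
    exact hb z

lemma vec_int (d : ℕ) (μ : Measure (EuclideanSpace ℝ (Fin d))) [IsProbabilityMeasure μ]
    (hmom : Integrable (fun z => ‖z‖ ^ 2) μ)
    (lam sig : ℝ) (hsig : 0 < sig) (x : EuclideanSpace ℝ (Fin d)) :
    Integrable (fun z : EuclideanSpace ℝ (Fin d) => gaussKernel d lam sig x z • z) μ := by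
  have hz : Integrable (fun z : EuclideanSpace ℝ (Fin d) => ‖z‖) μ := by
    refine ((integrable_const (1 : ℝ)).add hmom).mono'
      (Continuous.aestronglyMeasurable (by fun_prop)) (Filter.Eventually.of_forall fun z => ?_)
    simp only [Pi.add_apply, norm_norm]
    nlinarith [sq_nonneg (‖z‖ - 1), norm_nonneg z]
  refine (gk_mul_integrable d μ lam sig hsig x _ hz).mono' ?_
    (Filter.Eventually.of_forall fun z => ?_)
  · exact (gk_integrable d μ lam sig hsig x).aestronglyMeasurable.smul
      continuous_id.aestronglyMeasurable
  · rw [norm_smul, Real.norm_of_nonneg (gk_pos_s15 d lam sig hsig x z).le]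

lemma postMean_apply (d : ℕ) (μ : Measure (EuclideanSpace ℝ (Fin d))) [IsProbabilityMeasure μ]
    (hmom : Integrable (fun z => ‖z‖ ^ 2) μ)
    (lam sig : ℝ) (hsig : 0 < sig) (x : EuclideanSpace ℝ (Fin d)) (i : Fin d) :
    postMean d lam sig μ x i
      = (smoothedDensity d lam sig μ x)⁻¹ * ∫ z, gaussKernel d lam sig x z * z i ∂μ := by
  have h := (EuclideanSpace.proj (𝕜 := ℝ) i).integral_comp_comm (vec_int d μ hmom lam sig hsig x)
  simp only [PiLp.proj_apply, PiLp.smul_apply, smul_eq_mul] at h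
  simp only [postMean, PiLp.smul_apply, smul_eq_mul]
  rw [h]

lemma grad_eq (d : ℕ) (μ : Measure (EuclideanSpace ℝ (Fin d))) [IsProbabilityMeasure μ]
    (hmom : Integrable (fun z => ‖z‖ ^ 2) μ)
    (lam sig : ℝ) (hsig : 0 < sig) (x : EuclideanSpace ℝ (Fin d)) :
    gradient (fun x => Real.log (smoothedDensity d lam sig μ x)) x
      = (-(sig ^ 2)⁻¹) • (x - lam • postMean d lam sig μ x) := by
  have hf := sd_pos d μ lam sig hsig x
  have hv := vec_int d μ hmom lam sig hsig x
  have hk := gk_integrable d μ lam sig hsig x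
  have he : ∀ z, (gaussKernel d lam sig x z * (-(sig ^ 2)⁻¹)) • (x - lam • z)
      = (-(sig ^ 2)⁻¹) • (gaussKernel d lam sig x z • x - lam • (gaussKernel d lam sig x z • z)) := by
    intro z
    module
  have hint : Integrable
      (fun z => (gaussKernel d lam sig x z * (-(sig ^ 2)⁻¹)) • (x - lam • z)) μ := by
    simp only [he]
    exact ((hk.smul_const x).sub (hv.smul lam)).smul (-(sig ^ 2)⁻¹)
  have hval : ∫ z, (gaussKernel d lam sig x z * (-(sig ^ 2)⁻¹)) • (x - lam • z) ∂μ
      = smoothedDensity d lam sig μ x • ((-(sig ^ 2)⁻¹) • (x - lam • postMean d lam sig μ x)) := by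
    simp only [he]
    have hv' : Integrable (fun z => lam • (gaussKernel d lam sig x z • z)) μ := hv.smul lam
    rw [integral_smul, integral_sub (hk.smul_const x) hv', integral_smul_const,
      integral_smul]
    have hm : ∫ z, gaussKernel d lam sig x z • z ∂μ
        = smoothedDensity d lam sig μ x • postMean d lam sig μ x := by
      rw [postMean, smul_inv_smul₀ hf.ne']
    rw [hm]
    change _ • (smoothedDensity d lam sig μ x • x - _) = _
    module
  have hd := (sd_hasFDeriv d μ lam sig hsig x).log hf.ne'
  have hcomm := (innerSL ℝ (E := EuclideanSpace ℝ (Fin d))).integral_comp_comm hint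
  rw [hcomm, hval] at hd
  apply HasGradientAt.gradient
  rw [hasGradientAt_iff_hasFDerivAt]
  refine hd.congr_fderiv ?_
  ext v
  rw [map_smul, inv_smul_smul₀ hf.ne']
  rfl

lemma pointwise (d : ℕ) (μ : Measure (EuclideanSpace ℝ (Fin d))) [IsProbabilityMeasure μ]
    (hmom : Integrable (fun z => ‖z‖ ^ 2) μ)
    (lam sig : ℝ) (hsig : 0 < sig) (x : EuclideanSpace ℝ (Fin d)) :
    ∫ z, gaussKernel d lam sig x z * ‖x - lam • z‖ ^ 2 ∂μ
      = sig ^ 4 * (‖gradient (fun x => Real.log (smoothedDensity d lam sig μ x)) x‖ ^ 2 *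
          smoothedDensity d lam sig μ x)
        + lam ^ 2 * ((∑ i, postCov d lam sig μ x i i) * smoothedDensity d lam sig μ x) := by
  have hf := sd_pos d μ lam sig hsig x
  have hk := gk_integrable d μ lam sig hsig x
  have hka := fun i => gk_mul_integrable d μ lam sig hsig x _ (coord_int d μ hmom i).1
  have hkb := fun i => gk_mul_integrable d μ lam sig hsig x _ (coord_int d μ hmom i).2
  have quad : ∀ (i : Fin d) (p q : ℝ),
      Integrable (fun z => gaussKernel d lam sig x z * (p - q * z i) ^ 2) μ ∧
      ∫ z, gaussKernel d lam sig x z * (p - q * z i) ^ 2 ∂μ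
      = p ^ 2 * smoothedDensity d lam sig μ x
        - 2 * p * q * ∫ z, gaussKernel d lam sig x z * z i ∂μ
        + q ^ 2 * ∫ z, gaussKernel d lam sig x z * z i ^ 2 ∂μ := by
    intro i p q
    have e : ∀ z : EuclideanSpace ℝ (Fin d), gaussKernel d lam sig x z * (p - q * z i) ^ 2
        = p ^ 2 * gaussKernel d lam sig x z - 2 * p * q * (gaussKernel d lam sig x z * z i)
          + q ^ 2 * (gaussKernel d lam sig x z * z i ^ 2) := by
      intro z; ring
    simp only [e]
    have i1 := hk.const_mul (p ^ 2)
    have i2 := (hka i).const_mul (2 * p * q)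
    have i3 := (hkb i).const_mul (q ^ 2)
    have i12 : Integrable (fun z : EuclideanSpace ℝ (Fin d) => p ^ 2 * gaussKernel d lam sig x z
        - 2 * p * q * (gaussKernel d lam sig x z * z i)) μ := i1.sub i2
    refine ⟨i12.add i3, ?_⟩
    rw [integral_add i12 i3, integral_sub i1 i2, integral_const_mul, integral_const_mul,
      integral_const_mul]
    rfl
  have hg : ∫ z, gaussKernel d lam sig x z * ‖x - lam • z‖ ^ 2 ∂μ
      = ∑ i, ∫ z, gaussKernel d lam sig x z * (x i - lam * z i) ^ 2 ∂μ := by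
    rw [← integral_finsetSum _ fun i _ => (quad i (x i) lam).1]
    congr 1
    ext z
    rw [EuclideanSpace.norm_sq_eq, Finset.mul_sum]
    simp
  have hcov : ∀ i, postCov d lam sig μ x i i * smoothedDensity d lam sig μ x
      = ∫ z, gaussKernel d lam sig x z * (postMean d lam sig μ x i - 1 * z i) ^ 2 ∂μ := by
    intro i
    unfold postCov
    rw [mul_comm, mul_inv_cancel_left₀ hf.ne']
    congr 1
    ext z
    ring
  rw [hg, grad_eq d μ hmom lam sig hsig, Finset.sum_mul]
  rw [norm_smul, mul_pow, EuclideanSpace.norm_sq_eq, Finset.mul_sum, Finset.sum_mul, Finset.mul_sum,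
    Finset.mul_sum, ← Finset.sum_add_distrib]
  refine Finset.sum_congr rfl fun i _ => ?_
  rw [hcov, (quad _ _ _).2, (quad _ _ _).2]
  simp only [Real.norm_eq_abs, sq_abs, PiLp.sub_apply, PiLp.smul_apply, smul_eq_mul,
    postMean_apply d μ hmom lam sig hsig]
  field_simp
  ring

lemma cov_nonneg (d : ℕ) (μ : Measure (EuclideanSpace ℝ (Fin d))) [IsProbabilityMeasure μ]
    (lam sig : ℝ) (hsig : 0 < sig) (x : EuclideanSpace ℝ (Fin d)) :
    0 ≤ (∑ i, postCov d lam sig μ x i i) * smoothedDensity d lam sig μ x := by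
  have hf := sd_pos d μ lam sig hsig x
  refine mul_nonneg (Finset.sum_nonneg fun i _ => ?_) hf.le
  refine mul_nonneg (by positivity) (integral_nonneg fun z => ?_)
  exact mul_nonneg (gk_pos_s15 d lam sig hsig x z).le (mul_self_nonneg _)

lemma grad_meas (d : ℕ) (μ : Measure (EuclideanSpace ℝ (Fin d))) [IsProbabilityMeasure μ]
    (hmom : Integrable (fun z => ‖z‖ ^ 2) μ)
    (lam sig : ℝ) (hsig : 0 < sig) :
    Measurable (fun x => ‖gradient (fun x => Real.log (smoothedDensity d lam sig μ x)) x‖ ^ 2 *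
          smoothedDensity d lam sig μ x) := by
  have hc := gk_cont_s15 d lam sig
  have h1 : Measurable (smoothedDensity d lam sig μ) :=
    (hc.stronglyMeasurable.integral_prod_right (ν := μ)).measurable
  have h2 : Measurable (fun x => ∫ z, gaussKernel d lam sig x z • z ∂μ) :=
    ((by fun_prop : Continuous fun p : EuclideanSpace ℝ (Fin d) × EuclideanSpace ℝ (Fin d) =>
      gaussKernel d lam sig p.1 p.2 • p.2).stronglyMeasurable.integral_prod_right
        (ν := μ)).measurable
  have h3 : Measurable (postMean d lam sig μ) := h1.inv.smul h2
  simp only [grad_eq d μ hmom lam sig hsig]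
  fun_prop

theorem stmt15 (d : ℕ) (μ : Measure (EuclideanSpace ℝ (Fin d))) [IsProbabilityMeasure μ]
    (hmom : Integrable (fun z => ‖z‖ ^ 2) μ)
    (lam sig : ℝ) (hlam : lam ∈ Set.Ioc (0 : ℝ) 1) (hsig : 0 < sig) :
    (∫ x, ‖gradient (fun x => Real.log (smoothedDensity d lam sig μ x)) x‖ ^ 2 *
          smoothedDensity d lam sig μ x
        = (d : ℝ) / sig ^ 2 -
          lam ^ 2 / sig ^ 4 *
            ∫ x, (∑ i, postCov d lam sig μ x i i) * smoothedDensity d lam sig μ x) ∧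
    ∫ x, ‖gradient (fun x => Real.log (smoothedDensity d lam sig μ x)) x‖ ^ 2 *
          smoothedDensity d lam sig μ x
      ≤ (d : ℝ) / sig ^ 2 := by
  obtain ⟨hgi, hgv⟩ := fubini d μ lam sig hsig
  have hl : 0 < lam := hlam.1
  have hT := cov_nonneg d μ lam sig hsig
  have hp := pointwise d μ hmom lam sig hsig
  have hm := grad_meas d μ hmom lam sig hsig
  have hA0 : ∀ x, 0 ≤ ‖gradient (fun x => Real.log (smoothedDensity d lam sig μ x)) x‖ ^ 2 *
          smoothedDensity d lam sig μ x :=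
    fun x => mul_nonneg (by positivity) (sd_pos d μ lam sig hsig x).le
  simp only [hp] at hgi hgv
  set A : EuclideanSpace ℝ (Fin d) → ℝ := fun x =>
    ‖gradient (fun x => Real.log (smoothedDensity d lam sig μ x)) x‖ ^ 2 *
          smoothedDensity d lam sig μ x with hA
  set T : EuclideanSpace ℝ (Fin d) → ℝ := fun x =>
    (∑ i, postCov d lam sig μ x i i) * smoothedDensity d lam sig μ x with hTd
  change Integrable (fun x => sig ^ 4 * A x + lam ^ 2 * T x) at hgi
  change ∫ x, (sig ^ 4 * A x + lam ^ 2 * T x) = d * sig ^ 2 at hgv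
  have hAi : Integrable (fun x => sig ^ 4 * A x) := by
    refine hgi.mono' (hm.const_mul _).aestronglyMeasurable (Filter.Eventually.of_forall fun x => ?_)
    have h1 : 0 ≤ A x := hA0 x
    have h2 : 0 ≤ T x := hT x
    rw [Real.norm_of_nonneg (by positivity)]
    have : 0 ≤ lam ^ 2 * T x := by positivity
    linarith
  have hTi : Integrable (fun x => lam ^ 2 * T x) := by
    refine (hgi.sub hAi).congr (Filter.Eventually.of_forall fun x => ?_)
    simp
  rw [integral_add hAi hTi, integral_const_mul, integral_const_mul] at hgv
  have hT' : 0 ≤ ∫ x, T x := integral_nonneg hT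
  have key : ∫ x, A x = (d : ℝ) / sig ^ 2 - lam ^ 2 / sig ^ 4 * ∫ x, T x := by
    field_simp
    linarith
  refine ⟨key, ?_⟩
  rw [key]
  have : 0 ≤ lam ^ 2 / sig ^ 4 * ∫ x, T x := by positivity
  linarith
end
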